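/- Let Q = ℝⁿ × (0,∞) and let L be a nondivergence parabolic operator on Q with ellipticity constant ν. Let K ≥ 8 and R > 0 be constants, and let u be a solution of Lu = 0 in Q with u ≥ 0 on U_R = {(x,t) : t > 0, |x| ≤ K√t ≤ KR}. Define f₁(ρ) = inf of u over B_ρ(0) × {ρ²}. Then there is a constant γ₁ = γ₁(n,ν) > 0 such that for all ρ₀, ρ with 0 < 2ρ₀ ≤ ρ ≤ R, f₁(ρ) ≥ (ρ₀/ρ)^{γ₁} · inf_{ρ₀ ≤ r ≤ 2ρ₀} f₁(r). -/

import Mathlib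

open MeasureTheory Set Metric Filter

noncomputable section

/-- Euclidean space `ℝⁿ`. -/
abbrev E (n : ℕ) : Type := EuclideanSpace ℝ (Fin n)

/-- Second spatial partial derivative `D_i D_j u` at a space-time point `X`. -/
def D2 {n : ℕ} (u : E n × ℝ → ℝ) (X : E n × ℝ) (i j : Fin n) : ℝ :=
  fderiv ℝ (fun x => fderiv ℝ (fun x' => u (x', X.2)) x (EuclideanSpace.single j 1))
    X.1 (EuclideanSpace.single i 1)

/-- Time derivative `D_t u` at a space-time point `X`. -/
def Dt {n : ℕ} (u : E n × ℝ → ℝ) (X : E n × ℝ) : ℝ :=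
  deriv (fun t => u (X.1, t)) X.2

/-- The value `Lu(X)` of the nondivergence parabolic operator with coefficients `a`. -/
def LVal {n : ℕ} (a : E n × ℝ → Fin n → Fin n → ℝ) (u : E n × ℝ → ℝ) (X : E n × ℝ) : ℝ :=
  (∑ i, ∑ j, a X i j * D2 u X i j) - Dt u X

/-- `u` is C² in `x` and C¹ in `t` at every point of `V`. -/
def ParabolicSmoothOn {n : ℕ} (u : E n × ℝ → ℝ) (V : Set (E n × ℝ)) : Prop :=
  ∀ X ∈ V, ContDiffAt ℝ 2 (fun x => u (x, X.2)) X.1 ∧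
    DifferentiableAt ℝ (fun t => u (X.1, t)) X.2

/-- `u` solves `Lu = 0` pointwise in `V` (being C² in `x`, C¹ in `t` there). -/
def SolvesL {n : ℕ} (a : E n × ℝ → Fin n → Fin n → ℝ) (u : E n × ℝ → ℝ)
    (V : Set (E n × ℝ)) : Prop :=
  ParabolicSmoothOn u V ∧ ∀ X ∈ V, LVal a u X = 0

/-- `a` is a smooth coefficient matrix on `S`, uniformly elliptic with constant `ν`
and with entries bounded by `ν⁻¹`. -/
def IsParabolicCoeff {n : ℕ} (ν : ℝ) (a : E n × ℝ → Fin n → Fin n → ℝ)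
    (S : Set (E n × ℝ)) : Prop :=
  (∀ i j, ContDiffOn ℝ (⊤ : ℕ∞) (fun X => a X i j) S) ∧
  ∀ X ∈ S, (∀ ξ : Fin n → ℝ, ν * ∑ i, ξ i ^ 2 ≤ ∑ i, ∑ j, a X i j * ξ i * ξ j) ∧
    ∀ i j, |a X i j| ≤ ν⁻¹

/-- The cylinder `Ω × (t₀, ∞)`. -/
def CylFrom {n : ℕ} (Ω : Set (E n)) (t₀ : ℝ) : Set (E n × ℝ) := Ω ×ˢ Ioi t₀

/-- The cylinder `Q = Ω × (0, ∞)`. -/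
def Cyl {n : ℕ} (Ω : Set (E n)) : Set (E n × ℝ) := CylFrom Ω 0

/-- Parabolic boundary of the cylinder `Ω × (t₀, ∞)`:
`(∂Ω × (t₀,∞)) ∪ (cl(Ω) × {t₀})`. -/
def pBFrom {n : ℕ} (Ω : Set (E n)) (t₀ : ℝ) : Set (E n × ℝ) :=
  (frontier Ω ×ˢ Ioi t₀) ∪ (closure Ω ×ˢ {t₀})

/-- Parabolic boundary of `Ω × (0, ∞)`. -/
def pB {n : ℕ} (Ω : Set (E n)) : Set (E n × ℝ) := pBFrom Ω 0

/-- The cylinder `C_{R,r}(Y) = B_R(y) × (s - r², s + r²)`. -/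
def CRr {n : ℕ} (Y : E n × ℝ) (R r : ℝ) : Set (E n × ℝ) :=
  ball Y.1 R ×ˢ Ioo (Y.2 - r ^ 2) (Y.2 + r ^ 2)

/-- The standard cylinder `C_r(Y) = B_r(y) × (s - r², s + r²)`. -/
def Cr {n : ℕ} (Y : E n × ℝ) (r : ℝ) : Set (E n × ℝ) := CRr Y r r

/-- `ω` is the `L`-caloric measure family for the cylinder `Ω × (t₀, ∞)`:
each `ω X` is a Borel probability measure on the parabolic boundary, and for every
bounded continuous `φ`, `X ↦ ∫ φ dω^X` is a (bounded) solution of `Lu = 0` in the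
cylinder extending continuously to `φ` at each point of the parabolic boundary. -/
def IsCaloricMeasureFrom {n : ℕ} (a : E n × ℝ → Fin n → Fin n → ℝ) (Ω : Set (E n))
    (t₀ : ℝ) (ω : E n × ℝ → Measure (E n × ℝ)) : Prop :=
  (∀ X ∈ CylFrom Ω t₀, IsProbabilityMeasure (ω X) ∧ ω X (pBFrom Ω t₀)ᶜ = 0) ∧
  ∀ φ : E n × ℝ → ℝ, Continuous φ → (∃ M, ∀ z, |φ z| ≤ M) →
    SolvesL a (fun X => ∫ z, φ z ∂ω X) (CylFrom Ω t₀) ∧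
    ∀ Z ∈ pBFrom Ω t₀, Tendsto (fun X => ∫ z, φ z ∂ω X)
      (nhdsWithin Z (CylFrom Ω t₀)) (nhds (φ Z))

/-- `ω` is the `L`-caloric measure family for `Q = Ω × (0, ∞)`. -/
def IsCaloricMeasure {n : ℕ} (a : E n × ℝ → Fin n → Fin n → ℝ) (Ω : Set (E n))
    (ω : E n × ℝ → Measure (E n × ℝ)) : Prop :=
  IsCaloricMeasureFrom a Ω 0 ω

/-- `Ω` is a Lipschitz domain with constants `m, r₀ > 0`: it is a nonempty open
connected set and near each boundary point, in a suitable orthonormal coordinate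
system centered at that point, it coincides with the region above the graph of a
function with `‖∇φ‖_{L^∞} ≤ m` (equivalently, `m`-Lipschitz). -/
def IsLipschitzDomain {n : ℕ} (hn : 0 < n) (Ω : Set (E n)) (m r₀ : ℝ) : Prop :=
  IsOpen Ω ∧ Ω.Nonempty ∧ IsConnected Ω ∧ 0 < m ∧ 0 < r₀ ∧
  ∀ y ∈ frontier Ω, ∃ (T : E n ≃ₗᵢ[ℝ] E n) (φ : E (n - 1) → ℝ),
    LipschitzWith m.toNNReal φ ∧
    ∀ x : E n, x ∈ Ω ∩ ball y r₀ ↔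
      ‖x - y‖ < r₀ ∧
        φ ((EuclideanSpace.equiv (Fin (n - 1)) ℝ).symm
            (fun i => T (x - y) (Fin.castLE (Nat.sub_le n 1) i))) <
          T (x - y) ⟨n - 1, Nat.sub_lt hn Nat.one_pos⟩

/-- The set `Ω^δ = {x ∈ Ω : dist(x, ∂Ω) > δ}`. -/
def innerSet {n : ℕ} (Ω : Set (E n)) (δ : ℝ) : Set (E n) :=
  {x ∈ Ω | δ < infDist x (frontier Ω)}

/-- The corkscrew property (2.3) with constant `μ`. -/
def Corkscrew {n : ℕ} (Ω : Set (E n)) (r₀ μ : ℝ) : Prop :=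
  ∀ y ∈ frontier Ω, ∀ r : ℝ, 0 < r → r < r₀ →
    (∃ y₁ : E n, ball y₁ (2 * μ * r) ⊆ ball y r ∩ Ω) ∧
    (∃ y₂ : E n, ball y₂ (2 * μ * r) ⊆ ball y r \ Ω)


/-- pointwise regularity at one point -/
def PS {n : ℕ} (u : E n × ℝ → ℝ) (X : E n × ℝ) : Prop :=
  ContDiffAt ℝ 2 (fun x => u (x, X.2)) X.1 ∧ DifferentiableAt ℝ (fun t => u (X.1, t)) X.2

theorem diff_fderiv {n : ℕ} {g : E n → ℝ} {x : E n} (h : ContDiffAt ℝ 2 g x) :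
    DifferentiableAt ℝ (fderiv ℝ g) x := by
  have : ContDiffAt ℝ 1 (fderiv ℝ g) x := h.fderiv_right (by norm_num)
  exact this.differentiableAt (by norm_num)

theorem D2_eq {n : ℕ} {u : E n × ℝ → ℝ} {X : E n × ℝ}
    (h : ContDiffAt ℝ 2 (fun x => u (x, X.2)) X.1) (i j : Fin n) :
    D2 u X i j = fderiv ℝ (fderiv ℝ (fun x => u (x, X.2))) X.1
      (EuclideanSpace.single i 1) (EuclideanSpace.single j 1) := by
  unfold D2
  have := diff_fderiv h
  rw [fderiv_clm_apply this (differentiableAt_const _)]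
  simp

theorem PS.add {n : ℕ} {u v : E n × ℝ → ℝ} {X : E n × ℝ} (hu : PS u X) (hv : PS v X) :
    PS (fun Y => u Y + v Y) X := ⟨hu.1.add hv.1, hu.2.add hv.2⟩

theorem PS.cmul {n : ℕ} {u : E n × ℝ → ℝ} {X : E n × ℝ} (hu : PS u X) (c : ℝ) :
    PS (fun Y => c * u Y) X := ⟨contDiffAt_const.mul hu.1, hu.2.const_mul c⟩

theorem PS.sum {n : ℕ} {ι : Type*} (s : Finset ι) {u : ι → E n × ℝ → ℝ} {X : E n × ℝ}
    (hu : ∀ i ∈ s, PS (u i) X) :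
    PS (fun Y => ∑ i ∈ s, u i Y) X :=
  ⟨ContDiffAt.sum fun i hi => (hu i hi).1, DifferentiableAt.fun_sum fun i hi => (hu i hi).2⟩

theorem D2_add {n : ℕ} {u v : E n × ℝ → ℝ} {X : E n × ℝ} (hu : PS u X) (hv : PS v X)
    (i j : Fin n) : D2 (fun Y => u Y + v Y) X i j = D2 u X i j + D2 v X i j := by
  rw [D2_eq hu.1, D2_eq hv.1, D2_eq (hu.add hv).1]
  have : fderiv ℝ (fun x => u (x, X.2) + v (x, X.2)) =ᶠ[nhds X.1]
      fun x => fderiv ℝ (fun x => u (x, X.2)) x + fderiv ℝ (fun x => v (x, X.2)) x := by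
    filter_upwards [hu.1.eventually (by simp), hv.1.eventually (by simp)] with x h1 h2
    exact fderiv_fun_add (h1.differentiableAt (by norm_num)) (h2.differentiableAt (by norm_num))
  rw [this.fderiv_eq, fderiv_fun_add (diff_fderiv hu.1) (diff_fderiv hv.1)]
  simp

theorem D2_cmul {n : ℕ} {u : E n × ℝ → ℝ} {X : E n × ℝ} (hu : PS u X) (c : ℝ)
    (i j : Fin n) : D2 (fun Y => c * u Y) X i j = c * D2 u X i j := by
  rw [D2_eq hu.1, D2_eq (hu.cmul c).1]
  have : fderiv ℝ (fun x => c * u (x, X.2)) =ᶠ[nhds X.1]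
      fun x => c • fderiv ℝ (fun x => u (x, X.2)) x := by
    filter_upwards [hu.1.eventually (by simp)] with x h1
    exact fderiv_const_mul (h1.differentiableAt (by norm_num)) c
  rw [this.fderiv_eq, fderiv_fun_const_smul (diff_fderiv hu.1)]
  simp

theorem LVal_add {n : ℕ} {a : E n × ℝ → Fin n → Fin n → ℝ} {u v : E n × ℝ → ℝ} {X : E n × ℝ}
    (hu : PS u X) (hv : PS v X) :
    LVal a (fun Y => u Y + v Y) X = LVal a u X + LVal a v X := by
  unfold LVal
  simp only [D2_add hu hv, mul_add, Finset.sum_add_distrib]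
  have : Dt (fun Y => u Y + v Y) X = Dt u X + Dt v X := by
    unfold Dt; exact deriv_fun_add hu.2 hv.2
  rw [this]; ring

theorem LVal_cmul {n : ℕ} {a : E n × ℝ → Fin n → Fin n → ℝ} {u : E n × ℝ → ℝ} {X : E n × ℝ}
    (hu : PS u X) (c : ℝ) :
    LVal a (fun Y => c * u Y) X = c * LVal a u X := by
  unfold LVal
  simp only [D2_cmul hu]
  have : Dt (fun Y => c * u Y) X = c * Dt u X := by
    unfold Dt; exact deriv_const_mul c hu.2
  rw [this, mul_sub, Finset.mul_sum]
  congr 1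
  refine Finset.sum_congr rfl fun i _ => ?_
  rw [Finset.mul_sum]
  exact Finset.sum_congr rfl fun j _ => by ring

theorem LVal_zero {n : ℕ} {a : E n × ℝ → Fin n → Fin n → ℝ} {X : E n × ℝ} :
    LVal a (fun _ => 0) X = 0 := by
  simp [LVal, D2, Dt]

theorem LVal_sum {n : ℕ} {a : E n × ℝ → Fin n → Fin n → ℝ} {ι : Type*} (s : Finset ι)
    {u : ι → E n × ℝ → ℝ} {X : E n × ℝ}
    (hu : ∀ i ∈ s, PS (u i) X) :
    LVal a (fun Y => ∑ i ∈ s, u i Y) X = ∑ i ∈ s, LVal a (u i) X := by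
  classical
  induction s using Finset.induction_on with
  | empty => simpa using LVal_zero
  | insert i s hi ih =>
    simp only [Finset.sum_insert hi]
    have h1 : ∀ i ∈ s, PS (u i) X := fun j hj => hu j (Finset.mem_insert_of_mem hj)
    rw [LVal_add (hu i (Finset.mem_insert_self _ _)) (PS.sum s h1), ih h1]

/-- second order necessary condition -/
theorem snd_nonneg {n : ℕ} {g : E n → ℝ} {x : E n} (h : ContDiffAt ℝ 2 g x) (hm : IsLocalMin g x)
    (ξ : E n) : 0 ≤ fderiv ℝ (fderiv ℝ g) x ξ ξ := by
  by_contra hneg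
  push Not at hneg
  have hline : ∀ s : ℝ, HasDerivAt (fun s : ℝ => x + s • ξ) ξ s := fun s => by
    simpa using ((hasDerivAt_id s).smul_const ξ).const_add x
  have hc : Tendsto (fun s : ℝ => x + s • ξ) (nhds 0) (nhds x) := by
    have := (hline 0).continuousAt
    simpa [ContinuousAt] using this
  have h1 : deriv (fun s : ℝ => g (x + s • ξ)) =ᶠ[nhds 0] fun s => fderiv ℝ g (x + s • ξ) ξ := by
    filter_upwards [hc.eventually (h.eventually (by simp))] with s hs
    exact ((hs.differentiableAt (by norm_num)).hasFDerivAt.comp_hasDerivAt s (hline s)).deriv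
  have h2 : deriv (deriv (fun s : ℝ => g (x + s • ξ))) 0 = fderiv ℝ (fderiv ℝ g) x ξ ξ := by
    rw [h1.deriv_eq]
    have hd : HasFDerivAt (fderiv ℝ g) (fderiv ℝ (fderiv ℝ g) x) (x + (0:ℝ) • ξ) := by
      simpa using (diff_fderiv h).hasFDerivAt
    have h3 : HasDerivAt (fun s : ℝ => fderiv ℝ g (x + s • ξ)) (fderiv ℝ (fderiv ℝ g) x ξ) 0 :=
      HasFDerivAt.comp_hasDerivAt (f := fun s : ℝ => x + s • ξ) (l := fderiv ℝ g) 0 hd (hline 0)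
    have h4 : HasDerivAt (fun s : ℝ => fderiv ℝ g (x + s • ξ) ξ) (fderiv ℝ (fderiv ℝ g) x ξ ξ) 0 :=
      HasFDerivAt.comp_hasDerivAt (f := fun s : ℝ => fderiv ℝ g (x + s • ξ))
        (l := fun L : E n →L[ℝ] ℝ => L ξ) 0
        (ContinuousLinearMap.apply ℝ ℝ ξ).hasFDerivAt h3
    exact h4.deriv
  have hmin : IsLocalMin (fun s : ℝ => g (x + s • ξ)) 0 := by
    have := hc.eventually hm
    filter_upwards [this] with s hs
    simpa using hs
  have hcont : ContinuousAt (fun s : ℝ => g (x + s • ξ)) 0 := by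
    have : ContinuousAt g (x + (0:ℝ) • ξ) := by simpa using h.continuousAt
    exact ContinuousAt.comp (f := fun s : ℝ => x + s • ξ) this (hline 0).continuousAt
  have hmax := isLocalMax_of_deriv_deriv_neg (by rw [h2]; exact hneg) hmin.deriv_eq_zero hcont
  have heq : (fun s : ℝ => g (x + s • ξ)) =ᶠ[nhds 0] fun _ => g (x + (0:ℝ) • ξ) := by
    filter_upwards [hmin, hmax] with s h3 h4
    exact le_antisymm h4 h3
  have : deriv (deriv (fun s : ℝ => g (x + s • ξ))) 0 = 0 := by
    rw [heq.deriv.deriv_eq]; simp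
  rw [h2] at this
  linarith

theorem trace_nonneg {n : ℕ} {a H : Fin n → Fin n → ℝ}
    (ha : ∀ ξ : Fin n → ℝ, 0 ≤ ∑ i, ∑ j, a i j * ξ i * ξ j)
    (hs : ∀ i j, H i j = H j i) (hH : ∀ ξ : Fin n → ℝ, 0 ≤ ∑ i, ∑ j, ξ i * H i j * ξ j) :
    0 ≤ ∑ i, ∑ j, a i j * H i j := by
  have hp : (Matrix.of H).PosSemidef := by
    apply Matrix.PosSemidef.of_dotProduct_mulVec_nonneg
    · ext i j; simp [hs i j]
    · intro ξ
      have := hH ξ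
      simpa [dotProduct, Matrix.mulVec, Finset.mul_sum, mul_assoc] using this
  obtain ⟨m, v, hv⟩ := Matrix.posSemidef_iff_eq_sum_vecMulVec.1 hp
  have hv' : ∀ i j, H i j = ∑ k, v k i * v k j := fun i j => by
    have := congrFun (congrFun hv i) j
    simpa [Matrix.sum_apply, Matrix.vecMulVec_apply] using this
  have : ∑ i, ∑ j, a i j * H i j = ∑ k, ∑ i, ∑ j, a i j * v k i * v k j := by
    simp only [hv', Finset.mul_sum]
    rw [Finset.sum_congr rfl fun i _ => Finset.sum_comm]
    rw [Finset.sum_comm]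
    exact Finset.sum_congr rfl fun k _ => Finset.sum_congr rfl fun i _ =>
      Finset.sum_congr rfl fun j _ => by ring
  rw [this]
  exact Finset.sum_nonneg fun k _ => ha (v k)

theorem elliptic_nonneg {n : ℕ} {a : Fin n → Fin n → ℝ} {w : E n × ℝ → ℝ} {X : E n × ℝ}
    (ha : ∀ ξ : Fin n → ℝ, 0 ≤ ∑ i, ∑ j, a i j * ξ i * ξ j)
    (hw : PS w X) (hm : IsLocalMin (fun x => w (x, X.2)) X.1) :
    0 ≤ ∑ i, ∑ j, a i j * D2 w X i j := by
  apply trace_nonneg ha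
  · intro i j
    rw [D2_eq hw.1, D2_eq hw.1]
    exact (hw.1.isSymmSndFDerivAt (by simp)) _ _
  · intro ξ
    have := snd_nonneg hw.1 hm (∑ i, ξ i • EuclideanSpace.single i (1:ℝ))
    simp only [D2_eq hw.1]
    simp only [map_sum, map_smul, sum_apply, smul_apply, smul_eq_mul, Finset.mul_sum] at this
    rw [Finset.sum_comm]
    refine this.trans_eq ?_
    exact Finset.sum_congr rfl fun i _ => Finset.sum_congr rfl fun j _ => by ring


/-- lower semicontinuity from the future side -/
def RLsc {n : ℕ} (w : E n × ℝ → ℝ) (X : E n × ℝ) : Prop :=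
  ∀ c < w X, ∀ᶠ Y in nhdsWithin X {Y | X.2 ≤ Y.2}, c < w Y

theorem RLsc.add {n : ℕ} {w v : E n × ℝ → ℝ} {X : E n × ℝ} (hw : RLsc w X)
    (hv : ContinuousAt v X) : RLsc (fun Y => w Y + v Y) X := by
  intro c hc
  simp only at hc
  set d := (w X + v X - c) / 2 with hd
  have h1 := hw (w X - d) (by linarith)
  have h2 : ∀ᶠ Y in nhdsWithin X {Y | X.2 ≤ Y.2}, v X - d < v Y :=
    (hv.eventually_const_lt (by linarith)).filter_mono nhdsWithin_le_nhds
  filter_upwards [h1, h2] with Y a b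
  linarith

theorem comparison {n : ℕ} {a : E n × ℝ → Fin n → Fin n → ℝ} {w : E n × ℝ → ℝ}
    {K : Set (E n × ℝ)} (hK : IsCompact K) (hl : ∀ X ∈ K, RLsc w X)
    (hneg : ∀ X ∈ K, w X < 0 → PS w X ∧ LVal a w X < 0 ∧ (∀ᶠ x in nhds X.1, (x, X.2) ∈ K) ∧
      (∀ᶠ s in nhdsWithin X.2 (Iio X.2), (X.1, s) ∈ K) ∧
      ∀ ξ : Fin n → ℝ, 0 ≤ ∑ i, ∑ j, a X i j * ξ i * ξ j) :
    ∀ X ∈ K, 0 ≤ w X := by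
  rintro ⟨x₁, t₁⟩ hX
  by_contra hc0
  push Not at hc0
  set c := w (x₁, t₁) with hc
  set A : Set ℝ := {s | s ≤ t₁ ∧ ∀ s' ∈ Icc s t₁, ∃ x, (x, s') ∈ K ∧ w (x, s') ≤ c} with hA
  have htA : t₁ ∈ A := ⟨le_rfl, fun s' hs' => by
    obtain rfl : s' = t₁ := le_antisymm hs'.2 hs'.1
    exact ⟨x₁, hX, le_rfl⟩⟩
  have hbdd : BddBelow A := by
    obtain ⟨m, hm⟩ := (hK.image continuous_snd).bddBelow
    refine ⟨m, fun s hs => ?_⟩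
    obtain ⟨x, hx, _⟩ := hs.2 s ⟨le_rfl, hs.1⟩
    exact hm ⟨_, hx, rfl⟩
  set S := sInf A with hS
  have hSt : S ≤ t₁ := csInf_le hbdd htA
  have hlow : ∀ s', S < s' → s' ≤ t₁ → ∃ x, (x, s') ∈ K ∧ w (x, s') ≤ c := by
    intro s' h1 h2
    obtain ⟨s, hs, hss⟩ := exists_lt_of_csInf_lt ⟨_, htA⟩ h1
    exact hs.2 s' ⟨hss.le, h2⟩
  have hSpt : ∃ x, (x, S) ∈ K ∧ w (x, S) ≤ c := by
    rcases hSt.eq_or_lt with h | h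
    · rw [h]; exact ⟨x₁, hX, le_rfl⟩
    have hseq : ∀ j : ℕ, ∃ x, (x, S + (t₁ - S) / (j + 1)) ∈ K ∧ w (x, S + (t₁ - S) / (j + 1)) ≤ c := by
      intro j
      apply hlow
      · have : 0 < (t₁ - S) / ((j:ℝ) + 1) := div_pos (by linarith) (by positivity)
        linarith
      · have : (t₁ - S) / ((j:ℝ) + 1) ≤ t₁ - S :=
          div_le_self (by linarith) (by have : (0:ℝ) ≤ j := by positivity
                                        linarith)
        linarith
    choose x hx hxw using hseq
    obtain ⟨⟨y, s⟩, hy, φ, hφ, hlim⟩ := hK.tendsto_subseq hx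
    have ht : Tendsto (fun j : ℕ => S + (t₁ - S) / ((j:ℝ) + 1)) atTop (nhds S) := by
      have : Tendsto (fun j : ℕ => (t₁ - S) / ((j:ℝ) + 1)) atTop (nhds 0) := by
        have := (tendsto_one_div_add_atTop_nhds_zero_nat (𝕜 := ℝ)).const_mul (t₁ - S)
        simpa [div_eq_mul_inv] using this
      simpa using this.const_add S
    have hs : s = S := by
      have h1 : Tendsto (fun j => S + (t₁ - S) / ((φ j : ℝ) + 1)) atTop (nhds s) :=
        (continuous_snd.tendsto _).comp hlim
      exact tendsto_nhds_unique h1 (ht.comp hφ.tendsto_atTop)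
    subst hs
    refine ⟨y, hy, ?_⟩
    by_contra hlt
    push Not at hlt
    have hev := hl _ hy c hlt
    have hlim' : Tendsto ((fun j => (x j, S + (t₁ - S) / ((j:ℝ) + 1))) ∘ φ) atTop
        (nhdsWithin (y, S) {Y | (y, S).2 ≤ Y.2}) := by
      refine tendsto_nhdsWithin_iff.2 ⟨hlim, Eventually.of_forall fun j => ?_⟩
      simp only [mem_ofPred_eq, Function.comp]
      have : 0 < (t₁ - S) / ((φ j:ℝ) + 1) := div_pos (by linarith) (by positivity)
      linarith
    obtain ⟨j, hj⟩ := (hlim'.eventually hev).exists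
    exact absurd (hxw (φ j)) (not_le.2 hj)
  -- minimizer on the slice
  obtain ⟨x₂, hx₂, hx₂c⟩ := hSpt
  have hslice : IsCompact {x | (x, S) ∈ K} := by
    have h1 : IsCompact (Prod.fst '' (K ∩ {Y | Y.2 = S})) :=
      (hK.inter_right (isClosed_eq continuous_snd continuous_const)).image continuous_fst
    convert h1 using 1
    ext x; constructor
    · intro hx; exact ⟨(x, S), ⟨hx, rfl⟩, rfl⟩
    · rintro ⟨⟨x', s'⟩, ⟨h1, h2⟩, rfl⟩
      simp only [mem_ofPred_eq] at h2 ⊢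
      subst h2; exact h1
  have hlsc : LowerSemicontinuousOn (fun x => w (x, S)) {x | (x, S) ∈ K} := by
    intro x hx c' hc'
    have := hl _ hx c' hc'
    have ht : Tendsto (fun x' => (x', S)) (nhds x) (nhdsWithin (x, S) {Y : E n × ℝ | (x, S).2 ≤ Y.2}) := by
      refine tendsto_nhdsWithin_iff.2 ⟨?_, Eventually.of_forall fun j => by simp⟩
      exact (Continuous.prodMk_left S).tendsto x
    exact (ht.eventually this).filter_mono nhdsWithin_le_nhds
  obtain ⟨x₀, hx₀, hmin⟩ := hlsc.exists_isMinOn ⟨x₂, hx₂⟩ hslice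
  have hle : w (x₀, S) ≤ c := (hmin hx₂).trans hx₂c
  obtain ⟨hps, hL, hnx, hnt, hell⟩ := hneg _ hx₀ (by linarith)
  have hD := elliptic_nonneg hell hps (by
    filter_upwards [hnx] with x hx using hmin hx)
  have hDt : 0 < Dt w (x₀, S) := by
    unfold LVal at hL; linarith
  have hder : HasDerivAt (fun t => w (x₀, t)) (Dt w (x₀, S)) S := hps.2.hasDerivAt
  have hsl := (hasDerivAt_iff_tendsto_slope_left_right.1 hder).1.eventually_const_lt hDt
  have hev : ∀ᶠ s in nhdsWithin S (Iio S), (x₀, s) ∈ K ∧ w (x₀, s) ≤ c := by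
    filter_upwards [hsl, hnt, self_mem_nhdsWithin] with s h1 h2 h3
    refine ⟨h2, ?_⟩
    rw [slope_def_field] at h1
    have h3 : s < S := h3
    have : w (x₀, s) - w (x₀, S) < 0 := by
      by_contra hh
      push Not at hh
      have := div_nonpos_of_nonneg_of_nonpos hh (by linarith : s - S ≤ 0)
      linarith
    linarith
  obtain ⟨s₁, hs₁, hsub⟩ := mem_nhdsLT_iff_exists_Ioo_subset.1 hev
  have hs₁ : s₁ < S := hs₁
  have : (s₁ + S) / 2 ∈ A := by
    refine ⟨by linarith, fun s' hs' => ?_⟩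
    rcases lt_trichotomy s' S with h | h | h
    · have := hsub ⟨by linarith [hs'.1], h⟩
      exact ⟨x₀, this⟩
    · subst h; exact ⟨x₀, hx₀, hle⟩
    · exact hlow s' h hs'.2
  have := csInf_le hbdd this
  linarith


def mv {n : ℕ} (M : Fin n → Fin n → ℝ) (z : E n) (i : Fin n) : ℝ := ∑ j, M i j * z j

def qf {n : ℕ} (M : Fin n → Fin n → ℝ) (z : E n) : ℝ := ∑ i, z i * mv M z i

theorem hasFDeriv_coord {n : ℕ} (y x : E n) (i : Fin n) :
    HasFDerivAt (fun x : E n => (x - y) i) (EuclideanSpace.proj i : E n →L[ℝ] ℝ) x := by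
  have : HasFDerivAt (fun x : E n => x i - y i) (EuclideanSpace.proj i : E n →L[ℝ] ℝ) x :=
    (EuclideanSpace.proj (𝕜 := ℝ) i : E n →L[ℝ] ℝ).hasFDerivAt.sub_const (y i)
  exact this

theorem hasFDeriv_mv {n : ℕ} (M : Fin n → Fin n → ℝ) (y x : E n) (i : Fin n) :
    HasFDerivAt (fun x : E n => mv M (x - y) i)
      (∑ j, M i j • (EuclideanSpace.proj j : E n →L[ℝ] ℝ)) x := by
  unfold mv
  exact HasFDerivAt.fun_sum fun j _ => (hasFDeriv_coord y x j).const_mul (M i j)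

theorem hasFDeriv_qf {n : ℕ} {M : Fin n → Fin n → ℝ} (hM : ∀ i j, M i j = M j i) (y x : E n) :
    HasFDerivAt (fun x : E n => qf M (x - y))
      (∑ i, (2 * mv M (x - y) i) • (EuclideanSpace.proj i : E n →L[ℝ] ℝ)) x := by
  unfold qf
  have := HasFDerivAt.fun_sum (u := Finset.univ) fun i _ =>
    (hasFDeriv_coord y x i).mul (hasFDeriv_mv M y x i)
  refine this.congr_fderiv ?_
  apply ContinuousLinearMap.ext; intro v
  have hp : ∀ k : Fin n, (EuclideanSpace.proj k : E n →L[ℝ] ℝ) v = v k := fun k => rfl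
  simp only [sum_apply, smul_apply, add_apply, hp, smul_eq_mul,
    Finset.sum_add_distrib, Finset.mul_sum]
  have h : ∑ i, ∑ j, (x - y) i * (M i j * v j) = ∑ i, mv M (x - y) i * v i := by
    rw [Finset.sum_comm]
    refine Finset.sum_congr rfl fun i _ => ?_
    rw [mv, Finset.sum_mul]
    exact Finset.sum_congr rfl fun j _ => by rw [hM j i]; ring
  rw [h, ← Finset.sum_add_distrib]
  exact Finset.sum_congr rfl fun i _ => by ring

theorem contDiff_qf {n : ℕ} (M : Fin n → Fin n → ℝ) (y : E n) :
    ContDiff ℝ 2 (fun x : E n => qf M (x - y)) := by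
  have hc : ∀ i, ContDiff ℝ 2 (fun x : E n => (x - y) i) := fun i => by
    have : ContDiff ℝ 2 (fun x : E n => x i - y i) :=
      (EuclideanSpace.proj (𝕜 := ℝ) i : E n →L[ℝ] ℝ).contDiff.sub contDiff_const
    exact this
  unfold qf mv
  exact ContDiff.sum fun i _ => (hc i).mul (ContDiff.sum fun j _ => contDiff_const.mul (hc j))

theorem jetq {n : ℕ} {M : Fin n → Fin n → ℝ} (hM : ∀ i j, M i j = M j i) (y : E n)
    (f : ℝ → ℝ → ℝ) (X : E n × ℝ) (F1 : ℝ → ℝ) (F2 Ft : ℝ)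
    (hC : ContDiff ℝ 2 (fun q => f q X.2))
    (h1 : ∀ q, HasDerivAt (fun q => f q X.2) (F1 q) q)
    (h2 : HasDerivAt F1 F2 (qf M (X.1 - y)))
    (ht : HasDerivAt (fun t => f (qf M (X.1 - y)) t) Ft X.2) :
    PS (fun Y => f (qf M (Y.1 - y)) Y.2) X ∧
    ∀ a : E n × ℝ → Fin n → Fin n → ℝ, LVal a (fun Y => f (qf M (Y.1 - y)) Y.2) X =
      4 * F2 * (∑ i, ∑ j, a X i j * mv M (X.1 - y) i * mv M (X.1 - y) j) +
      2 * F1 (qf M (X.1 - y)) * (∑ i, ∑ j, a X i j * M i j) - Ft := by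
  refine ⟨⟨(hC.comp (contDiff_qf M y)).contDiffAt, ht.differentiableAt⟩, fun a => ?_⟩
  have hfd : ∀ x j, fderiv ℝ (fun x : E n => f (qf M (x - y)) X.2) x (EuclideanSpace.single j 1) =
      F1 (qf M (x - y)) * (2 * mv M (x - y) j) := by
    intro x j
    have := (h1 (qf M (x - y))).comp_hasFDerivAt x (hasFDeriv_qf hM y x)
    have h3 := this.fderiv
    simp only [Function.comp_def] at h3
    rw [h3]
    simp [sum_apply, PiLp.single_apply]
  have hD2 : ∀ i j, D2 (fun Y => f (qf M (Y.1 - y)) Y.2) X i j =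
      4 * F2 * (mv M (X.1 - y) i * mv M (X.1 - y) j) + 2 * F1 (qf M (X.1 - y)) * M i j := by
    intro i j
    unfold D2
    simp only [hfd]
    have h4 := (h2.comp_hasFDerivAt X.1 (hasFDeriv_qf hM y X.1)).mul
      ((hasFDeriv_mv M y X.1 j).const_mul 2)
    have h5 := h4.fderiv
    have h6 : fderiv ℝ (fun x => F1 (qf M (x - y)) * (2 * mv M (x - y) j)) X.1 = _ := h5
    rw [h6]
    simp [sum_apply, PiLp.single_apply, hM j i]
    ring
  unfold LVal
  simp only [hD2]
  have : Dt (fun Y => f (qf M (Y.1 - y)) Y.2) X = Ft := ht.deriv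
  rw [this]
  congr 1
  simp only [Finset.mul_sum, ← Finset.sum_add_distrib]
  exact Finset.sum_congr rfl fun i _ => Finset.sum_congr rfl fun j _ => by ring

/-- identity form -/
def idM {n : ℕ} (i j : Fin n) : ℝ := if i = j then 1 else 0

theorem idM_symm {n : ℕ} (i j : Fin n) : (idM i j : ℝ) = idM j i := by
  simp [idM, eq_comm]

theorem mv_id {n : ℕ} (z : E n) (i : Fin n) : mv idM z i = z i := by
  simp [mv, idM]

theorem qf_id {n : ℕ} (z : E n) : qf idM z = ‖z‖ ^ 2 := by
  rw [EuclideanSpace.norm_sq_eq]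
  simp [qf, mv_id, sq]

theorem sum_idM {n : ℕ} (a : Fin n → Fin n → ℝ) : ∑ i, ∑ j, a i j * idM i j = ∑ i, a i i := by
  simp [idM]


theorem inv_form {n : ℕ} (hn : 1 ≤ n) {ν : ℝ} (hν : 0 < ν) {a0 : Fin n → Fin n → ℝ}
    (hell : ∀ ξ : Fin n → ℝ, ν * ∑ i, ξ i ^ 2 ≤ ∑ i, ∑ j, a0 i j * ξ i * ξ j)
    (hb : ∀ i j, |a0 i j| ≤ ν⁻¹) :
    ∃ M : Fin n → Fin n → ℝ, (∀ i j, M i j = M j i) ∧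
      (∀ z : E n, ∑ i, ∑ j, a0 i j * mv M z i * mv M z j = qf M z) ∧
      (∑ i, ∑ j, a0 i j * M i j = n) ∧
      (∀ z : E n, ∑ i, mv M z i ^ 2 ≤ ‖z‖ ^ 2 / ν ^ 2) ∧
      (∀ i j, |M i j| ≤ ν⁻¹) ∧
      (∀ z : E n, ν ^ 3 / n ^ 2 * ‖z‖ ^ 2 ≤ qf M z ∧ qf M z ≤ ‖z‖ ^ 2 / ν) := by
  set A : Matrix (Fin n) (Fin n) ℝ := Matrix.of fun i j => (a0 i j + a0 j i) / 2 with hA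
  have hAs : ∀ i j, A i j = A j i := fun i j => by simp [hA, add_comm]
  have hform : ∀ ξ : Fin n → ℝ, ∑ i, ∑ j, a0 i j * ξ i * ξ j = ∑ i, ∑ j, A i j * ξ i * ξ j := by
    intro ξ
    have h1 : ∑ i, ∑ j, A i j * ξ i * ξ j =
        (∑ i, ∑ j, a0 i j * ξ i * ξ j) / 2 + (∑ i, ∑ j, a0 j i * ξ i * ξ j) / 2 := by
      simp only [Finset.sum_div, ← Finset.sum_add_distrib, hA, Matrix.of_apply]
      exact Finset.sum_congr rfl fun i _ => Finset.sum_congr rfl fun j _ => by ring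
    have h2 : ∑ i, ∑ j, a0 j i * ξ i * ξ j = ∑ i, ∑ j, a0 i j * ξ i * ξ j := by
      rw [Finset.sum_comm]
      exact Finset.sum_congr rfl fun i _ => Finset.sum_congr rfl fun j _ => by ring
    rw [h1, h2]; ring
  have hdet : IsUnit A.det := by
    rw [isUnit_iff_ne_zero]
    intro h0
    obtain ⟨v, hv, hv0⟩ := Matrix.exists_mulVec_eq_zero_iff.2 h0
    have h1 := hell v
    rw [hform] at h1
    have h2 : ∑ i, ∑ j, A i j * v i * v j = 0 := by
      have : ∀ i, ∑ j, A i j * v i * v j = v i * (A.mulVec v) i := fun i => by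
        rw [Matrix.mulVec, dotProduct, Finset.mul_sum]
        exact Finset.sum_congr rfl fun j _ => by ring
      simp [this, hv0]
    rw [h2] at h1
    have h3 : ∑ i, v i ^ 2 ≤ 0 := by
      by_contra hh; push Not at hh
      have := mul_pos hν hh; linarith
    apply hv
    ext i
    have h4 := (Finset.sum_eq_zero_iff_of_nonneg (fun i _ => sq_nonneg (v i))).1
      (le_antisymm h3 (Finset.sum_nonneg fun i _ => sq_nonneg (v i))) i (Finset.mem_univ i)
    simpa using h4
  set M : Matrix (Fin n) (Fin n) ℝ := A⁻¹ with hM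
  have hAM : A * M = 1 := Matrix.mul_nonsing_inv A hdet
  have hAM' : ∀ i k, ∑ j, A i j * M j k = if i = k then 1 else 0 := fun i k => by
    have := congrFun (congrFun hAM i) k
    simpa [Matrix.mul_apply, Matrix.one_apply] using this
  have hMs : ∀ i j, M i j = M j i := fun i j => by
    have h1 : A.transpose = A := by ext i j; simp [Matrix.transpose_apply, hAs j i]
    have h2 : M.transpose = M := by rw [hM, Matrix.transpose_nonsing_inv, h1]
    exact congrFun (congrFun h2 j) i
  have hAw : ∀ (z : E n) i, ∑ j, A i j * mv M z j = z i := by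
    intro z i
    simp only [mv, Finset.mul_sum]
    rw [Finset.sum_comm]
    have : ∀ k, ∑ j, A i j * (M j k * z k) = (∑ j, A i j * M j k) * z k := fun k => by
      rw [Finset.sum_mul]; exact Finset.sum_congr rfl fun j _ => by ring
    simp [this, hAM']
  have hq : ∀ z : E n, ∑ i, ∑ j, a0 i j * mv M z i * mv M z j = qf M z := by
    intro z
    rw [hform]; change _ = ∑ i, z i * mv M z i
    refine Finset.sum_congr rfl fun i _ => ?_
    rw [← hAw z i, Finset.sum_mul]
    exact Finset.sum_congr rfl fun j _ => by ring
  have hnz : ∀ z : E n, ‖z‖ ^ 2 = ∑ i, z i ^ 2 := fun z => by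
    rw [EuclideanSpace.norm_sq_eq]; simp
  have hCS : ∀ z : E n, (qf M z) ^ 2 ≤ ‖z‖ ^ 2 * ∑ i, mv M z i ^ 2 := fun z => by
    rw [hnz]; exact Finset.sum_mul_sq_le_sq_mul_sq _ _ _
  have hlow : ∀ z : E n, ν * ∑ i, mv M z i ^ 2 ≤ qf M z := fun z => by
    rw [← hq z]; exact hell _
  have hw0 : ∀ z : E n, 0 ≤ ∑ i, mv M z i ^ 2 := fun z =>
    Finset.sum_nonneg fun i _ => sq_nonneg _
  have hw : ∀ z : E n, ∑ i, mv M z i ^ 2 ≤ ‖z‖ ^ 2 / ν ^ 2 := by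
    intro z
    rw [le_div_iff₀ (by positivity)]
    rcases (hw0 z).eq_or_lt with h | h
    · rw [← h]; simp; 
    · have h1 : (ν * ∑ i, mv M z i ^ 2) ^ 2 ≤ (qf M z) ^ 2 :=
        pow_le_pow_left₀ (by positivity) (hlow z) 2
      have h2 := h1.trans (hCS z)
      nlinarith
  refine ⟨M, hMs, hq, ?_, hw, ?_, fun z => ⟨?_, ?_⟩⟩
  · have h1 : ∑ i, ∑ j, a0 i j * M i j = ∑ i, ∑ j, A i j * M j i := by
      have h2 : ∑ i, ∑ j, a0 j i * M j i = ∑ i, ∑ j, a0 i j * M i j := Finset.sum_comm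
      have h3 : ∑ i, ∑ j, A i j * M j i =
          (∑ i, ∑ j, a0 i j * M i j) / 2 + (∑ i, ∑ j, a0 j i * M j i) / 2 := by
        simp only [Finset.sum_div, ← Finset.sum_add_distrib, hA, Matrix.of_apply]
        exact Finset.sum_congr rfl fun i _ => Finset.sum_congr rfl fun j _ => by
          rw [hMs j i]; ring
      rw [h3, h2]; ring
    rw [h1]; simp [hAM']
  · intro i j
    have h1 := hw (EuclideanSpace.single j 1)
    have h2 : ∀ i, mv M (EuclideanSpace.single j (1:ℝ)) i = M i j := fun i => by
      simp [mv, PiLp.single_apply]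
    simp only [h2] at h1
    have h3 : M i j ^ 2 ≤ ∑ i, M i j ^ 2 :=
      Finset.single_le_sum (f := fun i => M i j ^ 2) (fun i _ => sq_nonneg _) (Finset.mem_univ i)
    apply abs_le_of_sq_le_sq _ (by positivity)
    have := h3.trans h1
    simpa using this
  · have h1 : ∀ i, z i ^ 2 ≤ n * ν⁻¹ ^ 2 * ∑ j, mv M z j ^ 2 := by
      intro i
      rw [← hAw z i]
      refine (Finset.sum_mul_sq_le_sq_mul_sq _ _ _).trans ?_
      refine mul_le_mul_of_nonneg_right ?_ (hw0 z)
      have : ∀ j ∈ Finset.univ, A i j ^ 2 ≤ ν⁻¹ ^ 2 := fun j _ => by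
        apply sq_le_sq'
        · have := abs_le.1 (hb i j); have := abs_le.1 (hb j i)
          simp only [hA, Matrix.of_apply]; linarith
        · have := abs_le.1 (hb i j); have := abs_le.1 (hb j i)
          simp only [hA, Matrix.of_apply]; linarith
      simpa using Finset.sum_le_sum this
    have h2 : ‖z‖ ^ 2 ≤ n * (n * ν⁻¹ ^ 2 * ∑ j, mv M z j ^ 2) := by
      rw [hnz]
      simpa using Finset.sum_le_sum (s := Finset.univ) fun i _ => h1 i
    have hn' : (0:ℝ) < n := by exact_mod_cast hn
    refine le_trans ?_ (hlow z)
    calc ν ^ 3 / n ^ 2 * ‖z‖ ^ 2 ≤ ν ^ 3 / n ^ 2 * (n * (n * ν⁻¹ ^ 2 * ∑ j, mv M z j ^ 2)) := by gcongr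
      _ = _ := by field_simp
  · have h1 := (hCS z).trans (mul_le_mul_of_nonneg_left (hw z) (by positivity))
    apply le_of_sq_le_sq _ (by positivity)
    refine h1.trans_eq ?_
    field_simp


def gam (α b s0 : ℝ) (q t : ℝ) : ℝ := (t - s0) ^ α * Real.exp (-q / (4 * b * (t - s0)))

theorem gam_nonneg {α b s0 q t : ℝ} (ht : s0 < t) : 0 ≤ gam α b s0 q t :=
  mul_nonneg (Real.rpow_nonneg (by linarith) _) (Real.exp_nonneg _)

theorem gam_cont {n : ℕ} (M : Fin n → Fin n → ℝ) (y : E n) {α b s0 : ℝ} (hb : 0 < b)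
    {X : E n × ℝ} (ht : s0 < X.2) :
    ContinuousAt (fun Y : E n × ℝ => gam α b s0 (qf M (Y.1 - y)) Y.2) X := by
  unfold gam
  have h0 : ContinuousAt (fun Y : E n × ℝ => Y.2 - s0) X := by fun_prop
  have hq : ContinuousAt (fun Y : E n × ℝ => qf M (Y.1 - y)) X := by
    have := (contDiff_qf M y).continuous
    exact (this.comp continuous_fst).continuousAt
  refine (h0.rpow_const (Or.inl (by linarith))).mul (Real.continuous_exp.continuousAt.comp ?_)
  exact hq.neg.div (continuousAt_const.mul h0) (by
    have : 0 < X.2 - s0 := by linarith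
    positivity)

theorem gam_jet {n : ℕ} {M : Fin n → Fin n → ℝ} (hM : ∀ i j, M i j = M j i) (y : E n)
    {α b s0 : ℝ} (hb : 0 < b) {X : E n × ℝ} (ht : s0 < X.2) :
    PS (fun Y : E n × ℝ => gam α b s0 (qf M (Y.1 - y)) Y.2) X ∧
    ∀ a : E n × ℝ → Fin n → Fin n → ℝ,
      LVal a (fun Y : E n × ℝ => gam α b s0 (qf M (Y.1 - y)) Y.2) X =
      gam α b s0 (qf M (X.1 - y)) X.2 *
        ((∑ i, ∑ j, a X i j * mv M (X.1 - y) i * mv M (X.1 - y) j) / (4 * b ^ 2 * (X.2 - s0) ^ 2) -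
         (∑ i, ∑ j, a X i j * M i j) / (2 * b * (X.2 - s0)) - α / (X.2 - s0) -
         qf M (X.1 - y) / (4 * b * (X.2 - s0) ^ 2)) := by
  set τ := X.2 - s0 with hτ
  have hτ0 : 0 < τ := by linarith
  set q0 := qf M (X.1 - y) with hq0
  have h1 : ∀ q, HasDerivAt (fun q => gam α b s0 q X.2) (gam α b s0 q X.2 * (-1 / (4 * b * τ))) q := by
    intro q
    have h := (((hasDerivAt_id q).neg.div_const (4 * b * τ)).exp).const_mul (τ ^ α)
    have h' : HasDerivAt (fun q => gam α b s0 q X.2) _ q := h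
    refine h'.congr_deriv ?_
    unfold gam
    rw [← hτ]; simp only [id, Pi.neg_apply]; ring
  have h2 : HasDerivAt (fun q => gam α b s0 q X.2 * (-1 / (4 * b * τ)))
      (gam α b s0 q0 X.2 * (-1 / (4 * b * τ)) * (-1 / (4 * b * τ))) q0 :=
    (h1 q0).mul_const _
  have h3 : HasDerivAt (fun t => gam α b s0 q0 t)
      (gam α b s0 q0 X.2 * (α / τ + q0 / (4 * b * τ ^ 2))) X.2 := by
    unfold gam
    have e1 : HasDerivAt (fun t : ℝ => t - s0) 1 X.2 := (hasDerivAt_id _).sub_const _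
    have e2 := e1.rpow_const (p := α) (Or.inl (by rw [← hτ]; exact hτ0.ne'))
    have e3 : HasDerivAt (fun t : ℝ => -q0 / (4 * b * (t - s0))) (q0 / (4 * b * τ ^ 2)) X.2 := by
      have := (hasDerivAt_const X.2 (-q0)).div (e1.const_mul (4 * b))
        (by rw [← hτ]; positivity)
      have h' : HasDerivAt (fun t : ℝ => -q0 / (4 * b * (t - s0))) _ X.2 := this
      refine h'.congr_deriv ?_
      rw [← hτ]; field_simp; ring
    have e4 : HasDerivAt (fun t => (t - s0) ^ α * Real.exp (-q0 / (4 * b * (t - s0)))) _ X.2 :=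
      e2.mul e3.exp
    refine e4.congr_deriv ?_
    simp only [← hτ]
    rw [Real.rpow_sub_one hτ0.ne']
    field_simp
  have hC : ContDiff ℝ 2 (fun q => gam α b s0 q X.2) := by
    unfold gam
    exact contDiff_const.mul ((contDiff_id.neg.div_const _).exp)
  obtain ⟨hps, hL⟩ := jetq hM y (gam α b s0) X _ _ _ hC h1 h2 h3
  refine ⟨hps, fun a => ?_⟩
  rw [hL a]
  rw [← hq0]
  field_simp
  ring

theorem gam_bound {n : ℕ} (hn : 1 ≤ n) {ν : ℝ} (hν : 0 < ν) (hν1 : ν ≤ 1)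
    {a0 M : Fin n → Fin n → ℝ} (hM : ∀ i j, M i j = M j i)
    (hM1 : ∀ z : E n, ∑ i, ∑ j, a0 i j * mv M z i * mv M z j = qf M z)
    (hM2 : ∑ i, ∑ j, a0 i j * M i j = n)
    (hM3 : ∀ z : E n, ∑ i, mv M z i ^ 2 ≤ ‖z‖ ^ 2 / ν ^ 2)
    (hM4 : ∀ i j, |M i j| ≤ ν⁻¹) (y : E n)
    {α b s0 : ℝ} (hb : 1 ≤ b) {X : E n × ℝ} (ht : s0 < X.2)
    {a : E n × ℝ → Fin n → Fin n → ℝ} {e : ℝ} (he : ∀ i j, |a X i j - a0 i j| ≤ e) (he0 : 0 ≤ e) :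
    LVal a (fun Y : E n × ℝ => gam α b s0 (qf M (Y.1 - y)) Y.2) X ≤
      gam α b s0 (qf M (X.1 - y)) X.2 *
        (- (qf M (X.1 - y) / (4 * b * (X.2 - s0) ^ 2) * (1 - 1 / b)) +
          (- n / (2 * b) - α) / (X.2 - s0) +
          e * (n ^ 2 / ν ^ 2) * (‖X.1 - y‖ ^ 2 / (X.2 - s0) ^ 2 + 1 / (X.2 - s0))) := by
  rw [(gam_jet hM y (by linarith) ht).2 a]
  refine mul_le_mul_of_nonneg_left ?_ (gam_nonneg ht)
  set τ := X.2 - s0 with hτ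
  have hτ0 : 0 < τ := by linarith
  set z := X.1 - y with hz
  have hn' : (1:ℝ) ≤ n := by exact_mod_cast hn
  have k1 : ∑ i, ∑ j, a X i j * mv M z i * mv M z j ≤ qf M z + e * (n * (‖z‖ ^ 2 / ν ^ 2)) := by
    rw [← hM1 z]
    have : ∑ i, ∑ j, a X i j * mv M z i * mv M z j ≤
        ∑ i, ∑ j, (a0 i j * mv M z i * mv M z j + e * (|mv M z i| * |mv M z j|)) := by
      refine Finset.sum_le_sum fun i _ => Finset.sum_le_sum fun j _ => ?_
      have h1 : (a X i j - a0 i j) * (mv M z i * mv M z j) ≤ e * (|mv M z i| * |mv M z j|) := by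
        rw [← abs_mul]
        refine (le_abs_self _).trans ?_
        rw [abs_mul]
        exact mul_le_mul_of_nonneg_right (he i j) (abs_nonneg _)
      linarith
    refine this.trans ?_
    simp only [Finset.sum_add_distrib]
    gcongr
    have h2 : ∑ i, ∑ j, e * (|mv M z i| * |mv M z j|) = e * (∑ i, |mv M z i|) ^ 2 := by
      rw [sq, Finset.sum_mul_sum]; simp only [Finset.mul_sum]
    rw [h2]
    gcongr
    have h3 := sq_sum_le_card_mul_sum_sq (s := Finset.univ) (f := fun i => |mv M z i|)
    simp only [sq_abs, Finset.card_univ, Fintype.card_fin] at h3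
    exact h3.trans (mul_le_mul_of_nonneg_left (hM3 z) (by positivity))
  have k2 : n - e * (n ^ 2 * ν⁻¹) ≤ ∑ i, ∑ j, a X i j * M i j := by
    have : ∑ i, ∑ j, (a0 i j * M i j - e * ν⁻¹) ≤ ∑ i, ∑ j, a X i j * M i j := by
      refine Finset.sum_le_sum fun i _ => Finset.sum_le_sum fun j _ => ?_
      have h1 : (a0 i j - a X i j) * M i j ≤ e * ν⁻¹ := by
        refine (le_abs_self _).trans ?_
        rw [abs_mul]
        exact mul_le_mul (by rw [abs_sub_comm]; exact he i j) (hM4 i j) (abs_nonneg _) he0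
      linarith
    refine le_trans (le_of_eq ?_) this
    simp only [Finset.sum_sub_distrib, Finset.sum_const, Finset.card_univ, Fintype.card_fin, nsmul_eq_mul, hM2]
    ring
  set P := ∑ i, ∑ j, a X i j * mv M z i * mv M z j
  set T := ∑ i, ∑ j, a X i j * M i j
  have hb0 : 0 < b := by linarith
  have l1 : P / (4 * b ^ 2 * τ ^ 2) ≤ (qf M z + e * (n * (‖z‖ ^ 2 / ν ^ 2))) / (4 * b ^ 2 * τ ^ 2) := by
    gcongr
  have l2 : (n - e * (n ^ 2 * ν⁻¹)) / (2 * b * τ) ≤ T / (2 * b * τ) := by gcongr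
  have l3 : e * (n * (‖z‖ ^ 2 / ν ^ 2)) / (4 * b ^ 2 * τ ^ 2) ≤ e * (n ^ 2 / ν ^ 2) * (‖z‖ ^ 2 / τ ^ 2) := by
    have h1 : (n:ℝ) ≤ n ^ 2 := by nlinarith
    have h2 : τ ^ 2 ≤ 4 * b ^ 2 * τ ^ 2 := by
      have : 1 ≤ 4 * b ^ 2 := by nlinarith
      nlinarith [sq_nonneg τ]
    calc e * (n * (‖z‖ ^ 2 / ν ^ 2)) / (4 * b ^ 2 * τ ^ 2) ≤ e * (n ^ 2 * (‖z‖ ^ 2 / ν ^ 2)) / (τ ^ 2) := by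
          gcongr
      _ = _ := by field_simp
  have l4 : e * (n ^ 2 * ν⁻¹) / (2 * b * τ) ≤ e * (n ^ 2 / ν ^ 2) * (1 / τ) := by
    have h2 : τ ≤ 2 * b * τ := by nlinarith
    have h3 : ν⁻¹ ≤ (ν ^ 2)⁻¹ := by
      apply inv_anti₀ (by positivity); nlinarith
    calc e * (n ^ 2 * ν⁻¹) / (2 * b * τ) ≤ e * (n ^ 2 * (ν ^ 2)⁻¹) / τ := by gcongr
      _ = _ := by field_simp
  have l5 : (qf M z + e * (n * (‖z‖ ^ 2 / ν ^ 2))) / (4 * b ^ 2 * τ ^ 2) =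
      qf M z / (4 * b * τ ^ 2) * (1 / b) + e * (n * (‖z‖ ^ 2 / ν ^ 2)) / (4 * b ^ 2 * τ ^ 2) := by
    field_simp
  have l6 : (n - e * (n ^ 2 * ν⁻¹)) / (2 * b * τ) = n / (2 * b) / τ - e * (n ^ 2 * ν⁻¹) / (2 * b * τ) := by
    field_simp
  have l7 : (- (n:ℝ) / (2 * b) - α) / τ = - (n / (2 * b) / τ) - α / τ := by ring
  rw [l7]
  rw [l5] at l1
  rw [l6] at l2
  linarith


/-- pure real inequality used to dominate the error of the frozen kernel -/
theorem kern_real {κ μ ζ τ q b : ℝ} (hκ : 0 < κ) (hκ1 : κ ≤ 1) (hμ : 0 < μ) (hμ1 : μ ≤ 1)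
    (hb : 1 / b = 1 - κ) (hb0 : 0 < b)
    (hζ : 0 ≤ ζ) (hτ : 0 < τ) (hτ1 : τ ≤ 1) (hq : μ * ζ ^ 2 ≤ q) :
    Real.exp (-q / (4 * 1 * τ)) * ((ζ + τ) * (ζ ^ 2 / τ ^ 2 + 1 / τ)) ≤
      2 * (8 / (κ * μ)) ^ 2 * (τ ^ (1/2 : ℝ) * Real.exp (-q / (4 * b * τ)) / τ) := by
  set w := ζ ^ 2 / τ with hw
  have hw0 : 0 ≤ w := by positivity
  have hs : τ ^ (1/2 : ℝ) = Real.sqrt τ := by rw [Real.sqrt_eq_rpow]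
  rw [hs]
  set s := Real.sqrt τ with hs'
  have hs0 : 0 < s := Real.sqrt_pos.2 hτ
  have hss : s * s = τ := Real.mul_self_sqrt hτ.le
  have hs1 : s ≤ 1 := by nlinarith
  have e1 : -q / (4 * b * τ) = -q / (4 * 1 * τ) + κ * q / (4 * τ) := by
    have : -q / (4 * b * τ) = (1 / b) * (-q / (4 * τ)) := by field_simp
    rw [this, hb]; ring
  have e2 : κ * μ * w / 4 ≤ κ * q / (4 * τ) := by
    rw [hw]
    have : κ * μ * (ζ ^ 2 / τ) / 4 = κ * (μ * ζ ^ 2) / (4 * τ) := by field_simp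
    rw [this]; gcongr
  have e3 : (κ * μ / 8) ^ 2 * (1 + w) ^ 2 ≤ Real.exp (κ * q / (4 * τ)) := by
    have h1 : κ * μ / 8 * (1 + w) ≤ Real.exp (κ * μ * w / 8) := by
      have := Real.add_one_le_exp (κ * μ * w / 8)
      have h2 : κ * μ ≤ 1 := by nlinarith
      nlinarith
    calc (κ * μ / 8) ^ 2 * (1 + w) ^ 2 = (κ * μ / 8 * (1 + w)) ^ 2 := by ring
      _ ≤ (Real.exp (κ * μ * w / 8)) ^ 2 := by gcongr
      _ = Real.exp (κ * μ * w / 4) := by rw [← Real.exp_nat_mul]; congr 1; push_cast; ring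
      _ ≤ _ := Real.exp_le_exp.2 e2
  have e4 : ζ + τ ≤ 2 * s * (1 + w) := by
    have h1 : ζ ≤ s * (1 + w) := by
      have h3 : ζ ^ 2 = w * τ := by rw [hw]; field_simp
      have h4 : 2 * (ζ * s) ≤ ζ ^ 2 + s ^ 2 := by nlinarith [sq_nonneg (ζ - s)]
      have h5 : ζ * s ≤ s * (1 + w) * s := by nlinarith
      exact le_of_mul_le_mul_right h5 hs0
    nlinarith [mul_nonneg hs0.le hw0]
  have e5 : ζ ^ 2 / τ ^ 2 + 1 / τ = (1 + w) / τ := by rw [hw]; field_simp; ring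
  rw [e1, Real.exp_add, e5]
  have hκμ : 0 < κ * μ := by positivity
  have e6 : (1 + w) ^ 2 ≤ (8 / (κ * μ)) ^ 2 * Real.exp (κ * q / (4 * τ)) := by
    have : (1 + w) ^ 2 = (8 / (κ * μ)) ^ 2 * ((κ * μ / 8) ^ 2 * (1 + w) ^ 2) := by field_simp
    rw [this]; gcongr
  calc Real.exp (-q / (4 * 1 * τ)) * ((ζ + τ) * ((1 + w) / τ))
      ≤ Real.exp (-q / (4 * 1 * τ)) * ((2 * s * (1 + w)) * ((1 + w) / τ)) := by gcongr
    _ = Real.exp (-q / (4 * 1 * τ)) * (2 * s / τ) * (1 + w) ^ 2 := by ring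
    _ ≤ Real.exp (-q / (4 * 1 * τ)) * (2 * s / τ) * ((8 / (κ * μ)) ^ 2 * Real.exp (κ * q / (4 * τ))) := by
        gcongr
    _ = _ := by ring

set_option maxHeartbeats 1000000 in
theorem kernel {n : ℕ} (hn : 1 ≤ n) {ν : ℝ} (hν : 0 < ν) (hν1 : ν ≤ 1) {Λ : ℝ} (hΛ : 0 ≤ Λ) :
    ∃ r C : ℝ, 0 < r ∧ r ≤ 1 ∧ 0 ≤ C ∧
    ∀ a0 : Fin n → Fin n → ℝ,
      (∀ ξ : Fin n → ℝ, ν * ∑ i, ξ i ^ 2 ≤ ∑ i, ∑ j, a0 i j * ξ i * ξ j) →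
      (∀ i j, |a0 i j| ≤ ν⁻¹) → ∀ (y : E n) (s0 : ℝ), ∃ G : E n × ℝ → ℝ,
      ∀ X : E n × ℝ, s0 < X.2 → ContinuousAt G X ∧ PS G X ∧ 0 ≤ G X ∧
        (X.2 - s0 ≤ 1 → G X ≤ C * (X.2 - s0) ^ (-(n:ℝ) / 2)) ∧
        (‖X.1 - y‖ ^ 2 ≤ X.2 - s0 →
          (X.2 - s0) ^ (-(n:ℝ) / 2) * Real.exp (-1 / (4 * ν)) ≤ G X) ∧
        ∀ a : E n × ℝ → Fin n → Fin n → ℝ, ‖X.1 - y‖ + (X.2 - s0) ≤ r →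
          (∀ i j, |a X i j - a0 i j| ≤ Λ * (‖X.1 - y‖ + (X.2 - s0))) → LVal a G X ≤ 0 := by
  have hn' : (1:ℝ) ≤ n := by exact_mod_cast hn
  have hn0 : (0:ℝ) < n := by linarith
  set b : ℝ := 1 + 1 / (2 * n) with hb
  set κ : ℝ := 1 / (2 * n + 1) with hκ
  set μ : ℝ := ν ^ 3 / n ^ 2 with hμ
  set D : ℝ := n ^ 2 / ν ^ 2 with hD
  have hb1 : 1 ≤ b := by rw [hb]; have : (0:ℝ) ≤ 1 / (2 * n) := by positivity
                         linarith
  have hb0 : 0 < b := by linarith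
  have hbκ : 1 / b = 1 - κ := by rw [hb, hκ]; field_simp; ring
  have hκ0 : 0 < κ := by positivity
  have hκ1 : κ ≤ 1 := by rw [hκ, div_le_one (by positivity)]; linarith
  have hμ0 : 0 < μ := by positivity
  have hμ1 : μ ≤ 1 := by
    rw [hμ, div_le_one (by positivity)]
    have : ν ^ 3 ≤ 1 := pow_le_one₀ hν.le hν1
    nlinarith
  have hD0 : 0 < D := by positivity
  set m0 : ℝ := min (1/8) (κ * μ / (4 * b)) with hm0
  have hm00 : 0 < m0 := lt_min (by norm_num) (by positivity)
  set r : ℝ := min 1 (m0 / (Λ * D + 1)) with hr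
  have hr0 : 0 < r := lt_min one_pos (by positivity)
  have hr1 : Λ * D * r ≤ m0 := by
    have h1 : r ≤ m0 / (Λ * D + 1) := min_le_right _ _
    calc Λ * D * r ≤ (Λ * D + 1) * (m0 / (Λ * D + 1)) := by
          gcongr; linarith
      _ = m0 := by field_simp
  set C2 : ℝ := 16 * (Λ * D) * (8 / (κ * μ)) ^ 2 with hC2
  have hC20 : 0 ≤ C2 := by positivity
  refine ⟨r, 1 + C2, hr0, min_le_left _ _, by linarith, ?_⟩
  intro a0 ha0 ha1 y s0
  obtain ⟨M, hM, hM1, hM2, hM3, hM4, hM5⟩ := inv_form hn hν ha0 ha1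
  refine ⟨fun Y => gam (-(n:ℝ)/2) 1 s0 (qf M (Y.1 - y)) Y.2 +
    C2 * gam (1/2 - (n:ℝ)/2) b s0 (qf M (Y.1 - y)) Y.2, ?_⟩
  intro X hX
  have j1 := gam_jet hM y (α := -(n:ℝ)/2) one_pos hX
  have j2 := gam_jet hM y (α := 1/2-(n:ℝ)/2) hb0 hX
  set τ := X.2 - s0 with hτ
  have hτ0 : 0 < τ := by linarith
  set z := X.1 - y with hz
  have hq0 : 0 ≤ qf M z := le_trans (by positivity) (hM5 z).1
  have hsp : τ ^ (1/2 - (n:ℝ)/2) = τ ^ (1/2:ℝ) * τ ^ (-(n:ℝ)/2) := by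
    rw [← Real.rpow_add hτ0]; congr 1; ring
  have hp0 : 0 < τ ^ (-(n:ℝ)/2) := Real.rpow_pos_of_pos hτ0 _
  refine ⟨(gam_cont M y one_pos hX).add (continuousAt_const.mul (gam_cont M y hb0 hX)),
    j1.1.add (j2.1.cmul C2), add_nonneg (gam_nonneg hX) (mul_nonneg hC20 (gam_nonneg hX)), ?_, ?_, ?_⟩
  · intro h1
    have g1 : gam (-(n:ℝ)/2) 1 s0 (qf M z) X.2 ≤ τ ^ (-(n:ℝ)/2) := by
      unfold gam
      rw [← hτ]
      refine mul_le_of_le_one_right hp0.le (Real.exp_le_one_iff.2 ?_)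
      exact div_nonpos_of_nonpos_of_nonneg (by linarith) (by positivity)
    have g2 : gam (1/2-(n:ℝ)/2) b s0 (qf M z) X.2 ≤ τ ^ (-(n:ℝ)/2) := by
      unfold gam
      rw [← hτ, hsp]
      have e1 : τ ^ (1/2:ℝ) ≤ 1 := Real.rpow_le_one hτ0.le h1 (by norm_num)
      have e2 : Real.exp (-qf M z / (4 * b * τ)) ≤ 1 := Real.exp_le_one_iff.2
        (div_nonpos_of_nonpos_of_nonneg (by linarith) (by positivity))
      calc _ ≤ 1 * τ ^ (-(n:ℝ)/2) * 1 := by gcongr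
        _ = _ := by ring
    have g3 := mul_le_mul_of_nonneg_left g2 hC20
    show gam (-(n:ℝ)/2) 1 s0 (qf M z) X.2 + C2 * gam (1/2-(n:ℝ)/2) b s0 (qf M z) X.2 ≤ _
    linarith
  · intro h1
    refine le_trans ?_ (le_add_of_nonneg_right (mul_nonneg hC20 (gam_nonneg hX)))
    unfold gam
    rw [← hτ]
    refine mul_le_mul_of_nonneg_left (Real.exp_le_exp.2 ?_) hp0.le
    rw [neg_div, neg_div, neg_le_neg_iff, div_le_div_iff₀ (by positivity) (by positivity)]
    have h2 := (hM5 z).2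
    have h3 : ‖z‖ ^ 2 / ν ≤ τ / ν := by gcongr
    have h4 : qf M z * ν ≤ τ := by
      have := h2.trans h3
      rwa [le_div_iff₀ hν] at this
    linarith
  · intro a h1 h2
    rw [LVal_add j1.1 (j2.1.cmul C2), LVal_cmul j2.1 C2]
    have hz0 := norm_nonneg z
    have he0 : 0 ≤ Λ * (‖z‖ + τ) := by positivity
    have b1 := gam_bound hn hν hν1 hM hM1 hM2 hM3 hM4 y (α := -(n:ℝ)/2) le_rfl hX h2 he0
    have b2 := gam_bound hn hν hν1 hM hM1 hM2 hM3 hM4 y (α := 1/2-(n:ℝ)/2) hb1 hX h2 he0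
    rw [← hτ, ← hz] at b1 b2
    have hτ1 : τ ≤ 1 := by have : r ≤ 1 := min_le_left _ _
                           linarith
    have kr := kern_real hκ0 hκ1 hμ0 hμ1 hbκ hb0 hz0 hτ0 hτ1 (hM5 z).1
    have g2 : gam (1/2-(n:ℝ)/2) b s0 (qf M z) X.2 =
        τ ^ (-(n:ℝ)/2) * (τ ^ (1/2:ℝ) * Real.exp (-qf M z / (4 * b * τ))) := by
      unfold gam
      rw [← hτ, hsp]; ring
    have g1 : gam (-(n:ℝ)/2) 1 s0 (qf M z) X.2 = τ ^ (-(n:ℝ)/2) * Real.exp (-qf M z / (4 * 1 * τ)) := by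
      unfold gam
      rw [← hτ]
    have c1 : LVal a (fun Y : E n × ℝ => gam (-(n:ℝ)/2) 1 s0 (qf M (Y.1 - y)) Y.2) X ≤
        C2 * (gam (1/2-(n:ℝ)/2) b s0 (qf M z) X.2 / (8 * τ)) := by
      refine b1.trans ?_
      rw [g1, g2]
      have : τ ^ (-(n:ℝ)/2) * Real.exp (-qf M z / (4 * 1 * τ)) *
          (-(qf M z / (4 * 1 * τ ^ 2) * (1 - 1 / 1)) + (-(n:ℝ) / (2 * 1) - -(n:ℝ) / 2) / τ +
          Λ * (‖z‖ + τ) * (n ^ 2 / ν ^ 2) * (‖z‖ ^ 2 / τ ^ 2 + 1 / τ)) =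
          (τ ^ (-(n:ℝ)/2) * (Λ * D)) * (Real.exp (-qf M z / (4 * 1 * τ)) * ((‖z‖ + τ) *
            (‖z‖ ^ 2 / τ ^ 2 + 1 / τ))) := by
        rw [hD]; ring
      rw [this]
      refine (mul_le_mul_of_nonneg_left kr (by positivity)).trans (le_of_eq ?_)
      rw [hC2]; ring
    have c2 : LVal a (fun Y : E n × ℝ => gam (1/2-(n:ℝ)/2) b s0 (qf M (Y.1 - y)) Y.2) X ≤
        - (gam (1/2-(n:ℝ)/2) b s0 (qf M z) X.2 / (8 * τ)) := by
      refine b2.trans ?_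
      have : - (gam (1/2-(n:ℝ)/2) b s0 (qf M z) X.2 / (8 * τ)) =
        gam (1/2-(n:ℝ)/2) b s0 (qf M z) X.2 * (-(1 / (8 * τ))) := by ring
      rw [this]
      refine mul_le_mul_of_nonneg_left ?_ (gam_nonneg hX)
      rw [← hD, hbκ]
      set w := ‖z‖ ^ 2 / τ with hw
      have hw0 : 0 ≤ w := by positivity
      have d1 : κ * μ / (4 * b) * w / τ ≤ qf M z / (4 * b * τ ^ 2) * (1 - (1 - κ)) := by
        have : κ * μ / (4 * b) * w / τ = μ * ‖z‖ ^ 2 / (4 * b * τ ^ 2) * κ := by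
          rw [hw]; field_simp
        rw [this, sub_sub_cancel]
        have := (hM5 z).1
        gcongr
      have d2 : (-(n:ℝ) / (2 * b) - (1/2 - n/2)) ≤ -(1/4) := by
        have h1 : -(n:ℝ) / (2 * b) = -(n/2) * (1 / b) := by field_simp
        rw [h1, hbκ]
        have h2 : n * κ ≤ 1/2 := by
          rw [hκ, mul_one_div, div_le_div_iff₀ (by positivity) (by positivity)]; linarith
        linarith
      have d3 : Λ * (‖z‖ + τ) * D ≤ m0 := by
        calc Λ * (‖z‖ + τ) * D ≤ Λ * r * D := by gcongr
          _ = Λ * D * r := by ring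
          _ ≤ m0 := hr1
      have d4 : ‖z‖ ^ 2 / τ ^ 2 + 1 / τ = (w + 1) / τ := by rw [hw]; field_simp
      rw [d4]
      have d5 : Λ * (‖z‖ + τ) * D * ((w + 1) / τ) ≤ κ * μ / (4 * b) * w / τ + 1/8 / τ := by
        have h1 : m0 ≤ 1/8 := min_le_left _ _
        have h2 : m0 ≤ κ * μ / (4 * b) := min_le_right _ _
        have h3 : Λ * (‖z‖ + τ) * D * (w + 1) ≤ κ * μ / (4 * b) * w + 1/8 := by
          have h4 := mul_le_mul_of_nonneg_right (d3.trans h2) hw0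
          have h5 := d3.trans h1
          linarith
        calc Λ * (‖z‖ + τ) * D * ((w + 1) / τ) = Λ * (‖z‖ + τ) * D * (w + 1) / τ := by ring
          _ ≤ (κ * μ / (4 * b) * w + 1/8) / τ := by gcongr
          _ = _ := by ring
      have d6 : (-(n:ℝ) / (2 * b) - (1/2 - n/2)) / τ ≤ -(1/4) / τ := by gcongr
      have d7 : -(1/4) / τ = - (2 * (1 / (8 * τ))) := by field_simp; norm_num
      have d8 : 1/8/τ = 1 / (8 * τ) := by field_simp
      linarith
    have := mul_le_mul_of_nonneg_left c2 hC20
    linarith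


theorem cover_lemma {n : ℕ} {Y : Set (E n)} (hY : IsCompact Y) {θ : ℝ} (hθ : 0 < θ) {B : Set (E n)}
    (hB : thickening θ Y ⊆ B) (hBf : volume B ≠ ⊤) :
    ∃ F : Finset (E n), (∀ y ∈ F, y ∈ Y) ∧ (∀ x ∈ Y, ∃ y ∈ F, ‖x - y‖ ≤ θ) ∧
      (F.card : ℝ) * ((θ / 5) ^ n * volume.real (ball (0 : E n) 1)) ≤ volume.real B := by
  obtain ⟨t, ht, htf, htc⟩ := hY.finite_cover_balls (show 0 < θ / 5 by positivity)
  obtain ⟨v, hv, hd, hc⟩ := Vitali.exists_disjoint_subfamily_covering_enlargement_closedBall t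
    (fun y : E n => y) (fun _ => θ / 5) (θ / 5) (fun _ _ => le_rfl) 5 (by norm_num)
  have hvf : v.Finite := htf.subset hv
  refine ⟨hvf.toFinset, fun y hy => ht (hv (by simpa using hy)), ?_, ?_⟩
  · intro x hx
    obtain ⟨y, hy, hxy⟩ := mem_iUnion₂.1 (htc hx)
    obtain ⟨b, hb, hyb⟩ := hc y hy
    refine ⟨b, by simpa using hb, ?_⟩
    have := hyb (ball_subset_closedBall hxy)
    rw [mem_closedBall, dist_eq_norm] at this
    linarith
  · have h1 : volume.real (⋃ y ∈ hvf.toFinset, closedBall y (θ / 5)) =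
        ∑ y ∈ hvf.toFinset, volume.real (closedBall y (θ / 5)) := by
      apply measureReal_biUnion_finset
      · simpa using hd
      · intro y _; exact isClosed_closedBall.measurableSet
      · intro y _; exact measure_closedBall_lt_top.ne
    have h2 : ∀ y : E n, volume.real (closedBall y (θ / 5)) =
        (θ / 5) ^ n * volume.real (ball (0 : E n) 1) := by
      intro y
      rw [measureReal_def, Measure.addHaar_closedBall _ _ (by positivity), ENNReal.toReal_mul,
        ENNReal.toReal_ofReal (by positivity)]
      simp [measureReal_def]
    have h3 : volume.real (⋃ y ∈ hvf.toFinset, closedBall y (θ / 5)) ≤ volume.real B := by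
      refine measureReal_mono (iUnion₂_subset fun y hy => ?_) hBf
      intro x hx
      apply hB
      rw [mem_thickening_iff]
      exact ⟨y, ht (hv (by simpa using hy)), lt_of_le_of_lt (mem_closedBall.1 hx) (by linarith)⟩
    rw [h1] at h3
    simpa [h2] using h3

def Good {n : ℕ} (ν Λ : ℝ) (a : E n × ℝ → Fin n → Fin n → ℝ) (u : E n × ℝ → ℝ)
    (V : Set (E n × ℝ)) : Prop :=
  (∀ X ∈ V, PS u X ∧ LVal a u X = 0 ∧ 0 ≤ u X ∧
    (∀ ξ : Fin n → ℝ, ν * ∑ i, ξ i ^ 2 ≤ ∑ i, ∑ j, a X i j * ξ i * ξ j) ∧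
    ∀ i j, |a X i j| ≤ ν⁻¹) ∧
  ∀ X ∈ V, ∀ Y ∈ V, ∀ i j, |a X i j - a Y i j| ≤ Λ * (‖X.1 - Y.1‖ + |X.2 - Y.2|)

theorem Good.mono {n : ℕ} {ν Λ : ℝ} {a : E n × ℝ → Fin n → Fin n → ℝ} {u : E n × ℝ → ℝ}
    {V W : Set (E n × ℝ)} (h : Good ν Λ a u V) (hWV : W ⊆ V) : Good ν Λ a u W :=
  ⟨fun X hX => h.1 X (hWV hX), fun X hX Y hY => h.2 X (hWV hX) Y (hWV hY)⟩

theorem v0_jet {n : ℕ} (c A m T : ℝ) (x1 : E n) (X : E n × ℝ) :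
    PS (fun Y : E n × ℝ => - c + A * ‖Y.1 - x1‖ ^ 2 + m * (Y.2 - T)) X ∧
    ∀ a : E n × ℝ → Fin n → Fin n → ℝ,
      LVal a (fun Y : E n × ℝ => - c + A * ‖Y.1 - x1‖ ^ 2 + m * (Y.2 - T)) X =
        2 * A * ∑ i, a X i i - m := by
  have h1 : ∀ q : ℝ, HasDerivAt (fun q : ℝ => - c + A * q + m * (X.2 - T)) A q := by
    intro q
    have : HasDerivAt (fun q : ℝ => - c + A * q + m * (X.2 - T)) (A * 1) q :=
      (((hasDerivAt_id q).const_mul A).const_add _).add_const _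
    simpa using this
  have h2 : HasDerivAt (fun _ : ℝ => A) 0 (qf idM (X.1 - x1)) := hasDerivAt_const _ _
  have h3 : HasDerivAt (fun t : ℝ => - c + A * (qf idM (X.1 - x1)) + m * (t - T)) m X.2 := by
    have : HasDerivAt (fun t : ℝ => - c + A * (qf idM (X.1 - x1)) + m * (t - T)) (m * 1) X.2 :=
      (((hasDerivAt_id X.2).sub_const T).const_mul m).const_add _
    simpa using this
  have hC : ContDiff ℝ 2 (fun q : ℝ => - c + A * q + m * (X.2 - T)) := by fun_prop
  have := jetq idM_symm x1 (fun q t => - c + A * q + m * (t - T)) X _ _ _ hC h1 h2 h3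
  simp only [qf_id] at this
  refine ⟨this.1, fun a => ?_⟩
  rw [this.2 a, sum_idM]; ring

set_option maxHeartbeats 1000000 in
theorem gap1 {n : ℕ} (hn : 1 ≤ n) {ν : ℝ} (hν : 0 < ν) (hν1 : ν ≤ 1) {Λ : ℝ} (hΛ : 0 ≤ Λ) :
    ∃ r C : ℝ, 0 < r ∧ r ≤ 1 ∧ 0 ≤ C ∧
    ∀ (a : E n × ℝ → Fin n → Fin n → ℝ) (u : E n × ℝ → ℝ) (x1 : E n) (r1 T t : ℝ), 0 < r1 →
      T < t → 2 * r1 + (t - T) < r → Good ν Λ a u (ball x1 (2 * r1) ×ˢ Icc T t) →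
      (∀ x ∈ closedBall x1 r1, ∀ s ∈ Icc T t, RLsc u (x, s)) →
      ∀ c c' A m : ℝ, 0 < c → c < c' → c ≤ A * r1 ^ 2 → 0 ≤ A → 2 * A * (n * ν⁻¹) < m →
      ∀ x ∈ closedBall x1 r1,
        c - A * ‖x - x1‖ ^ 2 - m * (t - T) -
          c * C * volume.real {x ∈ ball x1 (2 * r1) | u (x, T) < c'} * (t - T) ^ (-(n:ℝ)/2) ≤ u (x, t) := by
  obtain ⟨r, C0, hr0, hr1, hC0, hker⟩ := kernel hn hν hν1 hΛ
  set ω := volume.real (ball (0 : E n) 1) with hω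
  have hω0 : 0 < ω := by
    rw [hω, measureReal_def]
    exact ENNReal.toReal_pos (measure_ball_pos _ _ one_pos).ne' measure_ball_lt_top.ne
  refine ⟨r, Real.exp (1 / (4 * ν)) * C0 * 5 ^ n / ω, hr0, hr1, by positivity, ?_⟩
  intro a u x1 r1 T t hr1' hTt hrt hG hl c c' A m hc hcc hA hA0 hm
  set B := {x ∈ ball x1 (2 * r1) | u (x, T) < c'} with hB
  have hsub : closedBall x1 r1 ⊆ ball x1 (2 * r1) := closedBall_subset_ball (by linarith)
  have hcont : ContinuousOn (fun x => u (x, T)) (ball x1 (2 * r1)) := fun x hx =>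
    ((hG.1 (x, T) ⟨hx, left_mem_Icc.2 hTt.le⟩).1.1.continuousAt).continuousWithinAt
  have hBo : IsOpen B := hcont.isOpen_inter_preimage isOpen_ball (isOpen_Iio (a := c'))
  set Y := {x ∈ closedBall x1 r1 | u (x, T) ≤ c} with hY
  have hYc : IsCompact Y := (isCompact_closedBall x1 r1).of_isClosed_subset
    ((hcont.mono hsub).preimage_isClosed_of_isClosed isClosed_closedBall (isClosed_Iic (a := c)))
    (fun x hx => hx.1)
  have hYB : Y ⊆ B := fun x hx => ⟨hsub hx.1, lt_of_le_of_lt hx.2 hcc⟩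
  obtain ⟨θ0, hθ0, hθB⟩ := hYc.exists_thickening_subset_open hBo hYB
  obtain ⟨θ, hθ, hθ1, hθ2⟩ : ∃ θ : ℝ, 0 < θ ∧ θ ≤ θ0 ∧ 2 * r1 + (t - T) + θ ^ 2 ≤ r := by
    refine ⟨min θ0 (min 1 (r - (2 * r1 + (t - T)))), lt_min hθ0 (lt_min one_pos (by linarith)),
      min_le_left _ _, ?_⟩
    set θ := min θ0 (min 1 (r - (2 * r1 + (t - T)))) with hθ
    have h0 : 0 < θ := lt_min hθ0 (lt_min one_pos (by linarith))
    have h1 : θ ≤ 1 := (min_le_right _ _).trans (min_le_left _ _)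
    have h2 : θ ≤ r - (2 * r1 + (t - T)) := (min_le_right _ _).trans (min_le_right _ _)
    nlinarith
  have hBf : volume B ≠ ⊤ := ((measure_mono (fun x hx => hx.1)).trans_lt
    (measure_ball_lt_top (x := x1) (r := 2 * r1))).ne
  obtain ⟨F, hFY, hFc, hFv⟩ := cover_lemma hYc hθ ((thickening_mono hθ1 Y).trans hθB) hBf
  rw [← hω] at hFv
  set β : ℝ := c * Real.exp (1 / (4 * ν)) * θ ^ n with hβ
  have hβ0 : 0 < β := by positivity
  have hmemT : ∀ y ∈ Y, (y, T) ∈ ball x1 (2 * r1) ×ˢ Icc T t := fun y hy =>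
    ⟨hsub hy.1, left_mem_Icc.2 hTt.le⟩
  have hex : ∀ y : E n, ∃ G : E n × ℝ → ℝ, y ∈ Y →
      ∀ X : E n × ℝ, T - θ ^ 2 < X.2 → ContinuousAt G X ∧ PS G X ∧ 0 ≤ G X ∧
        (X.2 - (T - θ ^ 2) ≤ 1 → G X ≤ C0 * (X.2 - (T - θ ^ 2)) ^ (-(n:ℝ) / 2)) ∧
        (‖X.1 - y‖ ^ 2 ≤ X.2 - (T - θ ^ 2) →
          (X.2 - (T - θ ^ 2)) ^ (-(n:ℝ) / 2) * Real.exp (-1 / (4 * ν)) ≤ G X) ∧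
        ∀ a' : E n × ℝ → Fin n → Fin n → ℝ, ‖X.1 - y‖ + (X.2 - (T - θ ^ 2)) ≤ r →
          (∀ i j, |a' X i j - a (y, T) i j| ≤ Λ * (‖X.1 - y‖ + (X.2 - (T - θ ^ 2)))) → LVal a' G X ≤ 0 := by
    intro y
    by_cases hy : y ∈ Y
    · have := hG.1 (y, T) (hmemT y hy)
      obtain ⟨G, hG'⟩ := hker (a (y, T)) this.2.2.2.1 this.2.2.2.2 y (T - θ ^ 2)
      exact ⟨G, fun _ => hG'⟩
    · exact ⟨fun _ => 0, fun h => absurd h hy⟩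
  choose G hGk using hex
  have hθsq : 0 < θ ^ 2 := by positivity
  set h : E n × ℝ → ℝ := fun X => ∑ y ∈ F, β * G y X with hh
  set v : E n × ℝ → ℝ := fun X => - c + A * ‖X.1 - x1‖ ^ 2 + m * (X.2 - T) with hv
  have hvc : Continuous v := by rw [hv]; fun_prop
  set w : E n × ℝ → ℝ := fun X => u X + (v X + h X) with hw
  have hhc : ∀ X : E n × ℝ, T ≤ X.2 → ContinuousAt h X := by
    intro X hX
    rw [hh]
    refine tendsto_finsetSum _ fun y hy => ?_
    exact continuousAt_const.mul ((hGk y (hFY y hy) X (by linarith)).1)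
  have hh0 : ∀ X : E n × ℝ, T ≤ X.2 → 0 ≤ h X := by
    intro X hX
    exact Finset.sum_nonneg fun y hy => mul_nonneg hβ0.le (hGk y (hFY y hy) X (by linarith)).2.2.1
  have hm0 : 0 ≤ m := le_trans (by positivity) hm.le
  have key : ∀ X ∈ closedBall x1 r1 ×ˢ Icc T t, 0 ≤ w X := by
    refine comparison (a := a) ((isCompact_closedBall x1 r1).prod isCompact_Icc) ?_ ?_
    · rintro ⟨x, s⟩ ⟨hx, hs⟩
      exact (hl x hx s hs).add (hvc.continuousAt.add (hhc _ hs.1))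
    · rintro ⟨x, s⟩ ⟨hx, hs⟩ hneg
      simp only at hx hs
      have hgood := hG.1 (x, s) ⟨hsub hx, hs⟩
      have hwe : w (x, s) = u (x, s) + (-c + A * ‖x - x1‖ ^ 2 + m * (s - T) + h (x, s)) := rfl
      rw [hwe] at hneg
      have hhx := hh0 (x, s) hs.1
      have hms : 0 ≤ m * (s - T) := mul_nonneg hm0 (by linarith [hs.1])
      have hAx : 0 ≤ A * ‖x - x1‖ ^ 2 := by positivity
      have hxr : ‖x - x1‖ < r1 := by
        rw [mem_closedBall, dist_eq_norm] at hx
        refine lt_of_le_of_ne hx fun he => ?_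
        rw [he] at hneg
        linarith [hgood.2.2.1]
      have hsT : T < s := by
        refine lt_of_le_of_ne hs.1 fun he => ?_
        subst he
        have hxY : x ∈ Y := by
          refine ⟨hx, ?_⟩
          by_contra hcon
          push Not at hcon
          linarith
        obtain ⟨y, hyF, hxy⟩ := hFc x hxY
        have h1 := (hGk y (hFY y hyF) (x, T) (by simp only; linarith)).2.2.2.2.1
        simp only [sub_sub_cancel] at h1
        have h2 := h1 (by gcongr)
        have h3 : β * G y (x, T) ≤ h (x, T) := Finset.single_le_sum (f := fun y => β * G y (x, T))
          (fun y hy => mul_nonneg hβ0.le (hGk y (hFY y hy) (x, T) (by simp only; linarith)).2.2.1) hyF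
        have h4 : (θ ^ 2) ^ (-(n:ℝ)/2) = (θ ^ n)⁻¹ := by
          rw [← Real.rpow_natCast θ 2, ← Real.rpow_mul hθ.le, ← Real.rpow_natCast θ n,
            ← Real.rpow_neg hθ.le]
          congr 1; push_cast; ring
        have h5 : c = β * ((θ ^ 2) ^ (-(n:ℝ)/2) * Real.exp (-1 / (4 * ν))) := by
          rw [h4, hβ, neg_div, Real.exp_neg]
          field_simp
        have h6 := mul_le_mul_of_nonneg_left h2 hβ0.le
        rw [← h5] at h6
        linarith [hgood.2.2.1]
      have hGy : ∀ y ∈ F, PS (G y) (x, s) := fun y hy =>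
        (hGk y (hFY y hy) (x, s) (by simp only; linarith)).2.1
      have hsum : PS h (x, s) := PS.sum F (u := fun y X => β * G y X) (fun y hy => (hGy y hy).cmul β)
      have hvj := v0_jet c A m T x1 (x, s)
      refine ⟨hgood.1.add (hvj.1.add hsum), ?_, ?_, ?_, ?_⟩
      · rw [hw, LVal_add hgood.1 (hvj.1.add hsum), LVal_add hvj.1 hsum, hvj.2 a, hgood.2.1, hh,
          LVal_sum F (u := fun y X => β * G y X) (fun y hy => (hGy y hy).cmul β)]
        have e1 : ∑ y ∈ F, LVal a (fun X => β * G y X) (x, s) ≤ 0 := by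
          refine Finset.sum_nonpos fun y hy => ?_
          rw [LVal_cmul (hGy y hy)]
          refine mul_nonpos_of_nonneg_of_nonpos hβ0.le ?_
          have hyY := hFY y hy
          refine (hGk y hyY (x, s) (by simp only; linarith)).2.2.2.2.2 a ?_ ?_
          · simp only
            have d1 := hyY.1
            rw [mem_closedBall, dist_eq_norm] at d1
            have d2 : ‖x - y‖ ≤ ‖x - x1‖ + ‖y - x1‖ := by
              have := norm_sub_le (x - x1) (y - x1)
              simpa using this
            linarith [hs.2]
          · intro i j
            refine (hG.2 (x, s) ⟨hsub hx, hs⟩ (y, T) (hmemT y hyY) i j).trans ?_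
            simp only
            gcongr
            rw [abs_of_nonneg (by linarith)]
            linarith
        have e2 : ∑ i, a (x, s) i i ≤ n * ν⁻¹ := by
          calc ∑ i, a (x, s) i i ≤ ∑ _i : Fin n, ν⁻¹ :=
                Finset.sum_le_sum fun i _ => (le_abs_self _).trans (hgood.2.2.2.2 i i)
            _ = _ := by simp
        have e3 : 2 * A * ∑ i, a (x, s) i i ≤ 2 * A * (n * ν⁻¹) := by gcongr
        linarith
      · have : ball x1 r1 ∈ nhds x := isOpen_ball.mem_nhds (by rw [mem_ball, dist_eq_norm]; exact hxr)
        filter_upwards [this] with x' hx'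
        exact ⟨ball_subset_closedBall hx', hs⟩
      · have : Ioo T s ∈ nhdsWithin s (Iio s) := Ioo_mem_nhdsLT hsT
        filter_upwards [this] with s' hs'
        exact ⟨hx, hs'.1.le, hs'.2.le.trans hs.2⟩
      · intro ξ
        refine le_trans ?_ (hgood.2.2.2.1 ξ)
        exact mul_nonneg hν.le (Finset.sum_nonneg fun i _ => sq_nonneg _)
  intro x hx
  have hk := key (x, t) ⟨hx, right_mem_Icc.2 hTt.le⟩
  have hwe : w (x, t) = u (x, t) + (-c + A * ‖x - x1‖ ^ 2 + m * (t - T) + h (x, t)) := rfl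
  rw [hwe] at hk
  have hp : 0 < (t - T) ^ (-(n:ℝ)/2) := Real.rpow_pos_of_pos (by linarith) _
  have hhb : h (x, t) ≤ c * (Real.exp (1 / (4 * ν)) * C0 * 5 ^ n / ω) * volume.real B *
      (t - T) ^ (-(n:ℝ)/2) := by
    have e1 : ∀ y ∈ F, β * G y (x, t) ≤ β * (C0 * (t - T) ^ (-(n:ℝ)/2)) := by
      intro y hy
      have h1 := (hGk y (hFY y hy) (x, t) (by simp only; linarith)).2.2.2.1 (by simp only; linarith)
      simp only at h1
      refine mul_le_mul_of_nonneg_left (h1.trans (mul_le_mul_of_nonneg_left ?_ hC0)) hβ0.le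
      have hn0 : (0:ℝ) ≤ n := by positivity
      exact Real.rpow_le_rpow_of_nonpos (by linarith) (by linarith) (by linarith)
    calc h (x, t) ≤ ∑ y ∈ F, β * (C0 * (t - T) ^ (-(n:ℝ)/2)) := Finset.sum_le_sum e1
      _ = F.card * (β * (C0 * (t - T) ^ (-(n:ℝ)/2))) := by simp
      _ = c * (Real.exp (1 / (4 * ν)) * C0 * 5 ^ n / ω) * (F.card * ((θ / 5) ^ n * ω)) *
          (t - T) ^ (-(n:ℝ)/2) := by rw [hβ, div_pow]; field_simp
      _ ≤ _ := by gcongr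
  linarith


theorem gap2 {n : ℕ} (hn : 1 ≤ n) {ν : ℝ} (hν : 0 < ν) (hν1 : ν ≤ 1) {Λ : ℝ} (hΛ : 0 ≤ Λ) :
    ∃ r : ℝ, 0 < r ∧ 
    ∀ (a : E n × ℝ → Fin n → Fin n → ℝ) (u : E n × ℝ → ℝ) (x1 : E n) (r1 S t : ℝ), 0 < r1 →
      S < t → 2 * r1 + (t - S) < r → Good ν Λ a u (ball x1 (2 * r1) ×ˢ Icc S t) →
      (∀ x ∈ closedBall x1 r1, ∀ s ∈ Ioc S t, RLsc u (x, s)) →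
      ∀ c1 A m : ℝ, 0 < c1 → c1 ≤ A * r1 ^ 2 → 0 ≤ A → 2 * A * (n * ν⁻¹) < m →
      (∀ x ∈ ball x1 (2 * r1), c1 ≤ u (x, S)) →
      ∀ x ∈ closedBall x1 r1, c1 - A * ‖x - x1‖ ^ 2 - m * (t - S) ≤ u (x, t) := by
  obtain ⟨r, C, hr0, hr1, hC, hgap⟩ := gap1 hn hν hν1 hΛ
  refine ⟨r, hr0, ?_⟩
  intro a u x1 r1 S t hr1' hSt hrt hG hl c1 A m hc1 hA hA0 hm hS x hx
  refine le_of_forall_pos_lt_add fun ε hε => ?_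
  -- choose levels
  obtain ⟨c, hc0, hcc, hcε⟩ : ∃ c, 0 < c ∧ c < c1 ∧ c1 - c < ε := by
    refine ⟨max (c1 / 2) (c1 - ε / 2), lt_max_of_lt_left (by linarith), max_lt (by linarith) (by linarith), ?_⟩
    have := le_max_right (c1 / 2) (c1 - ε / 2)
    linarith
  set c' := (c + c1) / 2 with hc'
  set T : ℕ → ℝ := fun i => S + (t - S) / (i + 2) with hT
  have hd : 0 < t - S := by linarith
  have hTS : ∀ i, S < T i := fun i => by
    have : 0 < (t - S) / ((i:ℝ) + 2) := by positivity
    simp only [hT]; linarith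
  have hTt : ∀ i, T i < t := fun i => by
    have : (t - S) / ((i:ℝ) + 2) < t - S := by
      rw [div_lt_iff₀ (by positivity)]
      nlinarith [show (0:ℝ) ≤ i by positivity]
    simp only [hT]; linarith
  have hTlim : Tendsto T atTop (nhds S) := by
    have h1 : Tendsto (fun i : ℕ => (t - S) / ((i:ℝ) + 2)) atTop (nhds 0) :=
      Tendsto.div_atTop tendsto_const_nhds
        (tendsto_atTop_add_const_right _ _ tendsto_natCast_atTop_atTop)
    simpa using h1.const_add S
  set B : ℕ → Set (E n) := fun i => {x ∈ ball x1 (2 * r1) | u (x, T i) < c'} with hB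
  have hBm : ∀ i, MeasurableSet (B i) := fun i => by
    have hcont : ContinuousOn (fun x => u (x, T i)) (ball x1 (2 * r1)) := fun x hx =>
      ((hG.1 (x, T i) ⟨hx, (hTS i).le, (hTt i).le⟩).1.1.continuousAt).continuousWithinAt
    exact (hcont.isOpen_inter_preimage isOpen_ball (isOpen_Iio (a := c'))).measurableSet
  have hvol : Tendsto (fun i => volume.real (B i)) atTop (nhds 0) := by
    have h1 : Tendsto (fun i => volume (B i)) atTop (nhds (volume (∅ : Set (E n)))) := by
      refine tendsto_measure_of_tendsto_indicator atTop hBm (B := ball x1 (2 * r1))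
        isOpen_ball.measurableSet measure_ball_lt_top.ne ?_ ?_
      · exact Eventually.of_forall fun i x hx => hx.1
      · intro x
        by_cases hx : x ∈ ball x1 (2 * r1)
        · have h2 : ContinuousAt (fun s => u (x, s)) S :=
            (hG.1 (x, S) ⟨hx, left_mem_Icc.2 hSt.le⟩).1.2.continuousAt
          have h3 : c' < u (x, S) := by have := hS x hx; linarith
          filter_upwards [(h2.tendsto.comp hTlim).eventually_const_lt h3] with i hi
          simp only [Function.comp] at hi
          simp only [mem_empty_iff_false, iff_false]
          exact fun h => absurd h.2 (not_lt.2 hi.le)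
        · refine Eventually.of_forall fun i => ?_
          simp only [mem_empty_iff_false, iff_false]
          exact fun h => hx h.1
    have := (ENNReal.tendsto_toReal (by simp)).comp h1
    simpa [measureReal_def, Function.comp_def] using this
  have hlim : Tendsto (fun i => c - A * ‖x - x1‖ ^ 2 - m * (t - T i) -
      c * C * volume.real (B i) * (t - T i) ^ (-(n:ℝ)/2)) atTop
      (nhds (c - A * ‖x - x1‖ ^ 2 - m * (t - S) - c * C * 0 * (t - S) ^ (-(n:ℝ)/2))) := by
    have h1 : Tendsto (fun i => t - T i) atTop (nhds (t - S)) := hTlim.const_sub t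
    refine ((h1.const_mul m).const_sub _).sub ((hvol.const_mul _).mul ?_)
    exact h1.rpow_const (Or.inl hd.ne')
  have hfin := le_of_tendsto' hlim fun i => hgap a u x1 r1 (T i) t hr1' (hTt i)
    (by linarith [hTS i]) (hG.mono (prod_mono subset_rfl (Icc_subset_Icc_left (hTS i).le)))
    (fun x hx s hs => hl x hx s ⟨(hTS i).trans_le hs.1, hs.2⟩) c c' A m hc0 (by linarith)
    (by linarith) hA0 hm x hx
  linarith


/-- one step: RLsc at a time in the exceptional set on which `u` is equi-Lipschitz -/
theorem rlsc_step {n : ℕ} (hn : 1 ≤ n) {ν : ℝ} (hν : 0 < ν) (hν1 : ν ≤ 1) {Λ : ℝ} (hΛ : 0 ≤ Λ)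
    {a : E n × ℝ → Fin n → Fin n → ℝ} {u : E n × ℝ → ℝ} {x0 : E n} {r t1 η0 : ℝ}
    (hη0 : 0 < η0)
    (hG : Good ν Λ a u (ball x0 r ×ˢ Ioo (t1 - η0) (t1 + η0))) {O : Set ℝ} (hO : IsOpen O)
    (hOr : ∀ s ∈ O, ∀ x ∈ ball x0 r, RLsc u (x, s)) (ht1 : t1 ∉ O) {k : ℝ} (hk : 0 ≤ k)
    (hlip : ∀ s ∈ Ioo (t1 - η0) (t1 + η0), s ∉ O → ∀ x ∈ ball x0 r, ∀ y ∈ ball x0 r,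
      |u (x, s) - u (y, s)| ≤ k * ‖x - y‖) {x1 : E n} (hx1 : x1 ∈ ball x0 r) : RLsc u (x1, t1) := by
  obtain ⟨rk, hrk, hgap⟩ := gap2 hn hν hν1 hΛ
  intro c hc
  have hopen : ball x0 r ×ˢ Ioo (t1 - η0) (t1 + η0) ∈ nhds (x1, t1) :=
    (isOpen_ball.prod isOpen_Ioo).mem_nhds ⟨hx1, by simp only [mem_Ioo]; constructor <;> linarith⟩
  by_cases hc0 : c < 0
  · refine Eventually.filter_mono nhdsWithin_le_nhds ?_
    filter_upwards [hopen] with Y hY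
    exact lt_of_lt_of_le hc0 (hG.1 Y hY).2.2.1
  push Not at hc0
  set d := (u (x1, t1) - c) / 4 with hd
  have hd0 : 0 < d := by linarith
  obtain ⟨ε, hε, hεb⟩ := Metric.isOpen_iff.1 isOpen_ball x1 hx1
  obtain ⟨r1, hr1, hr1ε, hr1k, hr1d⟩ : ∃ r1 : ℝ, 0 < r1 ∧ 2 * r1 ≤ ε ∧ 2 * r1 ≤ rk / 2 ∧ k * (2 * r1) ≤ d := by
    refine ⟨min (ε / 2) (min (rk / 4) (d / (2 * (k + 1)))), by positivity, ?_, ?_, ?_⟩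
    · have := min_le_left (ε / 2) (min (rk / 4) (d / (2 * (k + 1)))); linarith
    · have := (min_le_right (ε / 2) (min (rk / 4) (d / (2 * (k + 1))))).trans (min_le_left _ _); linarith
    · have := (min_le_right (ε / 2) (min (rk / 4) (d / (2 * (k + 1))))).trans (min_le_right _ _)
      rw [le_div_iff₀ (by positivity)] at this
      have h2 : 0 < min (ε / 2) (min (rk / 4) (d / (2 * (k + 1)))) := by positivity
      nlinarith
  have hb2 : ball x1 (2 * r1) ⊆ ball x0 r := (ball_subset_ball hr1ε).trans hεb
  set c1 := c + 2 * d with hc1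
  have hc10 : 0 < c1 := by linarith
  set A := c1 / r1 ^ 2 with hA
  have hA0 : 0 ≤ A := by positivity
  set m := 2 * A * (n * ν⁻¹) + 1 with hm
  have hm0 : 0 < m := by positivity
  have htc : ContinuousAt (fun s => u (x1, s)) t1 :=
    (hG.1 (x1, t1) (mem_of_mem_nhds hopen)).1.2.continuousAt
  obtain ⟨η, hη, hηc⟩ := Metric.eventually_nhds_iff.1
    (htc.eventually_const_lt (show u (x1, t1) - d < u (x1, t1) by linarith))
  have hT : ∀ s ∈ Ioo (t1 - η0) (t1 + η0), s ∉ O → dist s t1 < η → ∀ x ∈ ball x1 (2 * r1), c1 ≤ u (x, s) := by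
    intro s hs hsO hsη x hx
    have h1 := hηc hsη
    have h2 := hlip s hs hsO x (hb2 hx) x1 hx1
    rw [mem_ball, dist_eq_norm] at hx
    have h3 : k * ‖x - x1‖ ≤ k * (2 * r1) := by gcongr
    have h4 := neg_abs_le (u (x, s) - u (x1, s))
    linarith
  have ev1 : ∀ᶠ Y in nhds (x1, t1), ‖Y.1 - x1‖ < r1 := by
    have : Continuous fun Y : E n × ℝ => ‖Y.1 - x1‖ := by fun_prop
    exact this.continuousAt.eventually_lt_const (by simpa using hr1)
  have ev2 : ∀ᶠ Y in nhds (x1, t1), A * ‖Y.1 - x1‖ ^ 2 < d := by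
    have : Continuous fun Y : E n × ℝ => A * ‖Y.1 - x1‖ ^ 2 := by fun_prop
    exact this.continuousAt.eventually_lt_const (by simpa using hd0)
  have ev3 : ∀ᶠ Y in nhds (x1, t1), m * (Y.2 - t1) < d := by
    have : Continuous fun Y : E n × ℝ => m * (Y.2 - t1) := by fun_prop
    exact this.continuousAt.eventually_lt_const (by simpa using hd0)
  have ev4 : ∀ᶠ Y in nhds (x1, t1), dist Y.2 t1 < min η (rk / 2) := by
    have : Continuous fun Y : E n × ℝ => dist Y.2 t1 := by fun_prop
    exact this.continuousAt.eventually_lt_const (by simp; constructor <;> positivity)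
  filter_upwards [nhdsWithin_le_nhds ev1, nhdsWithin_le_nhds ev2, nhdsWithin_le_nhds ev3,
    nhdsWithin_le_nhds ev4, nhdsWithin_le_nhds hopen, self_mem_nhdsWithin] with Y h1 h2 h3 h4 h5 h6
  obtain ⟨x, t⟩ := Y
  simp only at h1 h2 h3 h4 h6
  have h6 : t1 ≤ t := h6
  have ht : t ∈ Ioo (t1 - η0) (t1 + η0) := h5.2
  have hη' := h4.trans_le (min_le_left _ _)
  have hrk' := h4.trans_le (min_le_right _ _)
  rw [Real.dist_eq, abs_of_nonneg (by linarith)] at hrk'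
  have hxb : x ∈ ball x1 (2 * r1) := by rw [mem_ball, dist_eq_norm]; linarith
  by_cases htO : t ∈ O
  swap
  · have := hT t ht htO hη' x hxb
    linarith
  -- gap case
  set Z := Icc t1 t \ O with hZ
  have hZc : IsCompact Z := isCompact_Icc.diff hO
  have hZn : Z.Nonempty := ⟨t1, ⟨le_rfl, h6⟩, ht1⟩
  obtain ⟨S, hSZ, hSmax⟩ := hZc.exists_isGreatest hZn
  have hSt : S < t := lt_of_le_of_ne hSZ.1.2 fun h => hSZ.2 (h ▸ htO)
  have hS1 : S ∈ Ioo (t1 - η0) (t1 + η0) := ⟨by linarith [hSZ.1.1], by linarith [ht.2]⟩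
  have hdS : dist S t1 < η := by
    rw [Real.dist_eq, abs_of_nonneg (by linarith)] at hη'
    rw [Real.dist_eq, abs_of_nonneg (by linarith [hSZ.1.1])]
    linarith
  have hfin := hgap a u x1 r1 S t hr1 hSt (by linarith [hSZ.1.1])
    (hG.mono (prod_mono hb2 fun s hs => ⟨by linarith [hS1.1, hs.1], by linarith [ht.2, hs.2]⟩))
    (fun x' hx' s hs => hOr s (by
      by_contra hsO
      have : s ≤ S := hSmax ⟨⟨by linarith [hSZ.1.1, hs.1], hs.2⟩, hsO⟩
      linarith [hs.1]) x' (hb2 (closedBall_subset_ball (by linarith) hx')))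
    c1 A m hc10 (by rw [hA]; field_simp; exact le_rfl) hA0 (by linarith)
    (fun x' hx' => hT S hS1 hSZ.2 hdS x' hx') x (by rw [mem_closedBall, dist_eq_norm]; exact h1.le)
  have h7 : m * (t - S) ≤ m * (t - t1) := by
    have := hSZ.1.1
    gcongr
  show c < u (x, t)
  linarith

theorem rlsc_local {n : ℕ} (hn : 1 ≤ n) {ν : ℝ} (hν : 0 < ν) (hν1 : ν ≤ 1) {Λ : ℝ} (hΛ : 0 ≤ Λ)
    {a : E n × ℝ → Fin n → Fin n → ℝ} {u : E n × ℝ → ℝ} {x0 : E n} {R0 r α β : ℝ} (hr : r < R0)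
    (hG : Good ν Λ a u (ball x0 R0 ×ˢ Ioo α β)) :
    ∀ t ∈ Ioo α β, ∀ x ∈ ball x0 r, RLsc u (x, t) := by
  set O : Set ℝ := {t | ∃ δ > 0, ∀ s, |s - t| < δ → ∀ x ∈ ball x0 r, RLsc u (x, s)} with hO
  have hOo : IsOpen O := by
    rw [Metric.isOpen_iff]
    rintro t ⟨δ, hδ, h⟩
    refine ⟨δ / 2, by positivity, fun t' ht' => ⟨δ / 2, by positivity, fun s hs => h s ?_⟩⟩
    rw [mem_ball, Real.dist_eq] at ht'
    have := abs_sub_le s t' t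
    linarith
  have hOr : ∀ s ∈ O, ∀ x ∈ ball x0 r, RLsc u (x, s) := by
    rintro s ⟨δ, hδ, h⟩
    exact h s (by simpa using hδ)
  set T : Set ℝ := Ioo α β ∩ Oᶜ with hT
  suffices hTe : T = ∅ by
    intro t ht
    refine hOr t ?_
    by_contra htO
    have : t ∈ T := ⟨ht, htO⟩
    rw [hTe] at this
    exact this
  by_contra hne
  have hne : T.Nonempty := nonempty_iff_ne_empty.2 hne
  have hlc : IsLocallyClosed T := ⟨Ioo α β, Oᶜ, isOpen_Ioo, hOo.isClosed_compl, rfl⟩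
  haveI : LocallyCompactSpace T := hlc.locallyCompactSpace
  haveI : Nonempty T := hne.to_subtype
  have hrs : closedBall x0 r ⊆ ball x0 R0 := closedBall_subset_ball hr
  set C : ℕ → Set T := fun k => {t | ∀ x ∈ closedBall x0 r, ∀ y ∈ closedBall x0 r,
    |u (x, (t:ℝ)) - u (y, (t:ℝ))| ≤ k * ‖x - y‖} with hC
  have hct : ∀ x ∈ closedBall x0 r, Continuous fun t : T => u (x, (t:ℝ)) := by
    intro x hx
    rw [continuous_iff_continuousAt]
    intro t
    have h1 : ContinuousAt (fun s => u (x, s)) (t:ℝ) :=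
      (hG.1 (x, (t:ℝ)) ⟨hrs hx, t.2.1⟩).1.2.continuousAt
    exact ContinuousAt.comp (f := fun t : T => (t:ℝ)) (g := fun s => u (x, s)) h1
      continuous_subtype_val.continuousAt
  have hCc : ∀ k, IsClosed (C k) := by
    intro k
    have : C k = ⋂ x ∈ closedBall x0 r, ⋂ y ∈ closedBall x0 r,
        {t : T | |u (x, (t:ℝ)) - u (y, (t:ℝ))| ≤ k * ‖x - y‖} := by
      ext t; simp [hC]
    rw [this]
    refine isClosed_biInter fun x hx => isClosed_biInter fun y hy => ?_
    exact isClosed_le ((hct x hx).sub (hct y hy)).abs continuous_const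
  have hCu : ⋃ k, C k = univ := by
    rw [eq_univ_iff_forall]
    intro t
    have hLL : LocallyLipschitzOn (closedBall x0 r) (fun x => u (x, (t:ℝ))) := by
      intro x hx
      have h1 := (hG.1 (x, (t:ℝ)) ⟨hrs hx, t.2.1⟩).1.1
      obtain ⟨K, s, hs, hK⟩ := (h1.of_le one_le_two).exists_lipschitzOnWith
      exact ⟨K, s, mem_nhdsWithin_of_mem_nhds hs, hK⟩
    obtain ⟨K, hK⟩ := hLL.exists_lipschitzOnWith_of_compact (isCompact_closedBall x0 r)
    obtain ⟨k, hk⟩ := exists_nat_ge (K : ℝ)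
    refine mem_iUnion.2 ⟨k, fun x hx y hy => ?_⟩
    have := hK.dist_le_mul x hx y hy
    rw [Real.dist_eq, dist_eq_norm] at this
    exact this.trans (by gcongr)
  obtain ⟨k, ⟨ts, hts⟩⟩ := nonempty_interior_of_iUnion_of_closed hCc hCu
  rw [mem_interior_iff_mem_nhds, Metric.mem_nhds_iff] at hts
  obtain ⟨δ, hδ, hδC⟩ := hts
  obtain ⟨δ2, hδ2, hδI⟩ := Metric.isOpen_iff.1 isOpen_Ioo (ts:ℝ) ts.2.1
  refine ts.2.2 ⟨min δ δ2 / 2, by positivity, fun t1 ht1 x1 hx1 => ?_⟩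
  by_cases htO : t1 ∈ O
  · exact hOr t1 htO x1 hx1
  have hnear : ∀ s ∈ Ioo (t1 - min δ δ2 / 2) (t1 + min δ δ2 / 2), dist s ts < min δ δ2 := by
    intro s hs
    rw [Real.dist_eq]
    have h1 : |s - t1| < min δ δ2 / 2 := by rw [abs_lt]; constructor <;> linarith [hs.1, hs.2]
    have := abs_sub_le s t1 ts
    linarith
  have hIn : ∀ s ∈ Ioo (t1 - min δ δ2 / 2) (t1 + min δ δ2 / 2), s ∈ Ioo α β := fun s hs =>
    hδI ((hnear s hs).trans_le (min_le_right _ _))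
  refine rlsc_step hn hν hν1 hΛ (η0 := min δ δ2 / 2) (by positivity)
    (hG.mono (prod_mono (ball_subset_ball hr.le) hIn)) hOo hOr htO (k := k) (by positivity) ?_ hx1
  intro s hs hsO x hx y hy
  have : (⟨s, hIn s hs, hsO⟩ : T) ∈ C k := hδC ((hnear s hs).trans_le (min_le_left _ _))
  exact this x (ball_subset_closedBall hx) y (ball_subset_closedBall hy)


theorem rlsc_interior {n : ℕ} (hn : 1 ≤ n) {ν : ℝ} (hν : 0 < ν) (hν1 : ν ≤ 1)
    {a : E n × ℝ → Fin n → Fin n → ℝ} (ha : IsParabolicCoeff ν a (closure (Cyl (univ : Set (E n)))))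
    {u : E n × ℝ → ℝ} (hu : SolvesL a u (Cyl (univ : Set (E n)))) {X : E n × ℝ} (hX : 0 < X.2)
    (hpos : ∀ᶠ Y in nhds X, 0 ≤ u Y) : RLsc u X := by
  have hCo : IsOpen (Cyl (univ : Set (E n))) := isOpen_univ.prod isOpen_Ioi
  have hXC : X ∈ Cyl (univ : Set (E n)) := ⟨mem_univ _, hX⟩
  have hnC : Cyl (univ : Set (E n)) ∈ nhds X := hCo.mem_nhds hXC
  have hcd : ContDiffAt ℝ 1 a X := by
    refine contDiffAt_pi.2 fun i => contDiffAt_pi.2 fun j => ?_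
    have h1 := (ha.1 i j).contDiffAt (x := X) (mem_of_superset hnC subset_closure)
    exact h1.of_le (by exact_mod_cast le_top)
  obtain ⟨Λ, s, hs, hΛ⟩ := hcd.exists_lipschitzOnWith
  obtain ⟨ε, hε, hb⟩ := Metric.mem_nhds_iff.1 (inter_mem (inter_mem hs hnC) hpos)
  have hG : Good ν (Λ:ℝ) a u (ball X.1 ε ×ˢ Ioo (X.2 - ε) (X.2 + ε)) := by
    have hsub : ball X.1 ε ×ˢ Ioo (X.2 - ε) (X.2 + ε) ⊆ ball X ε := by
      rw [← Real.ball_eq_Ioo, ball_prod_same]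
    constructor
    · intro Y hY
      have h1 := hb (hsub hY)
      have h2 := ha.2 Y (subset_closure h1.1.2)
      exact ⟨hu.1 Y h1.1.2, hu.2 Y h1.1.2, h1.2, h2.1, h2.2⟩
    · intro Y hY Z hZ i j
      have h1 := hΛ.dist_le_mul Y (hb (hsub hY)).1.1 Z (hb (hsub hZ)).1.1
      have h2 : |a Y i j - a Z i j| ≤ dist (a Y) (a Z) := by
        rw [← Real.dist_eq]
        exact (dist_le_pi_dist (a Y i) (a Z i) j).trans (dist_le_pi_dist (a Y) (a Z) i)
      refine h2.trans (h1.trans ?_)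
      gcongr
      rw [Prod.dist_eq, dist_eq_norm, Real.dist_eq]
      exact max_le_add_of_nonneg (norm_nonneg _) (abs_nonneg _)
  exact rlsc_local hn hν hν1 Λ.2 (half_lt_self hε) hG X.2
    ⟨by linarith, by linarith⟩ X.1 (mem_ball_self (by positivity))

/-- minus the barrier -/
def bar (Φ γ s0 q t : ℝ) : ℝ := -(Φ * ((t - s0) ^ (-γ) * (1 - q / (64 * (t - s0))) ^ 2))

theorem bar_jet {n : ℕ} {Φ γ s0 : ℝ} {X : E n × ℝ} (hX : s0 < X.2) :
    PS (fun Y : E n × ℝ => bar Φ γ s0 (‖Y.1‖ ^ 2) Y.2) X ∧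
    ∀ a : E n × ℝ → Fin n → Fin n → ℝ,
      LVal a (fun Y : E n × ℝ => bar Φ γ s0 (‖Y.1‖ ^ 2) Y.2) X =
      Φ * (X.2 - s0) ^ (-γ) / (X.2 - s0) * (
        - (∑ i, ∑ j, a X i j * X.1 i * X.1 j) / (512 * (X.2 - s0)) +
        (1 - ‖X.1‖ ^ 2 / (64 * (X.2 - s0))) * ((∑ i, a X i i) / 16)
        - γ * (1 - ‖X.1‖ ^ 2 / (64 * (X.2 - s0))) ^ 2 +
        2 * (1 - ‖X.1‖ ^ 2 / (64 * (X.2 - s0))) * (‖X.1‖ ^ 2 / (64 * (X.2 - s0)))) := by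
  set τ := X.2 - s0 with hτ
  have hτ0 : 0 < τ := by linarith
  set q0 := qf idM (X.1 - 0) with hq0
  have h1 : ∀ q, HasDerivAt (fun q => bar Φ γ s0 q X.2)
      (Φ * τ ^ (-γ) * (1 - q / (64 * τ)) / (32 * τ)) q := by
    intro q
    have h := ((((((hasDerivAt_id q).div_const (64 * τ)).const_sub 1).pow 2).const_mul
      (τ ^ (-γ))).const_mul Φ).neg
    have h' : HasDerivAt (fun q => bar Φ γ s0 q X.2) _ q := h
    refine h'.congr_deriv ?_
    simp only [id, show 2 - 1 = 1 from rfl, pow_one, Nat.cast_ofNat]; field_simp; ring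
  have h2 : HasDerivAt (fun q => Φ * τ ^ (-γ) * (1 - q / (64 * τ)) / (32 * τ))
      (-(Φ * τ ^ (-γ) / (2048 * τ ^ 2))) q0 := by
    have h := ((((hasDerivAt_id q0).div_const (64 * τ)).const_sub 1).const_mul
      (Φ * τ ^ (-γ))).div_const (32 * τ)
    have h' : HasDerivAt (fun q => Φ * τ ^ (-γ) * (1 - q / (64 * τ)) / (32 * τ)) _ q0 := h
    refine h'.congr_deriv ?_
    field_simp; ring
  have h3 : HasDerivAt (fun t => bar Φ γ s0 q0 t)
      (Φ * τ ^ (-γ) / τ * (γ * (1 - q0 / (64 * τ)) ^ 2 - 2 * (1 - q0 / (64 * τ)) * (q0 / (64 * τ)))) X.2 := by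
    have e1 : HasDerivAt (fun t : ℝ => t - s0) 1 X.2 := (hasDerivAt_id _).sub_const _
    have e2 := e1.rpow_const (p := -γ) (Or.inl (by rw [← hτ]; exact hτ0.ne'))
    have e3 : HasDerivAt (fun t : ℝ => q0 / (64 * (t - s0))) (- q0 / (64 * τ ^ 2)) X.2 := by
      have := (hasDerivAt_const X.2 q0).div (e1.const_mul 64)
        (by rw [← hτ]; positivity)
      have h' : HasDerivAt (fun t : ℝ => q0 / (64 * (t - s0))) _ X.2 := this
      refine h'.congr_deriv ?_
      rw [← hτ]; field_simp; ring
    have e4 := ((e2.mul ((e3.const_sub 1).pow 2)).const_mul Φ).neg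
    have h' : HasDerivAt (fun t => bar Φ γ s0 q0 t) _ X.2 := e4
    refine h'.congr_deriv ?_
    simp only [Pi.pow_apply, ← hτ, show 2 - 1 = 1 from rfl, pow_one, Nat.cast_ofNat]
    rw [Real.rpow_sub_one hτ0.ne']
    field_simp
    ring
  have hC : ContDiff ℝ 2 (fun q => bar Φ γ s0 q X.2) := by
    unfold bar
    exact (contDiff_const.mul (contDiff_const.mul ((contDiff_const.sub (contDiff_id.div_const _)).pow 2))).neg
  have hj := jetq idM_symm 0 (bar Φ γ s0) X _ _ _ hC h1 h2 h3
  simp only [sub_zero, qf_id, mv_id, sum_idM] at hj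
  refine ⟨hj.1, fun a => ?_⟩
  rw [hj.2 a, hq0, sub_zero, qf_id]
  field_simp
  ring

theorem bar_cont {n : ℕ} {Φ γ s0 : ℝ} {X : E n × ℝ} (hX : s0 < X.2) :
    ContinuousAt (fun Y : E n × ℝ => bar Φ γ s0 (‖Y.1‖ ^ 2) Y.2) X := by
  unfold bar
  have h0 : ContinuousAt (fun Y : E n × ℝ => Y.2 - s0) X := by fun_prop
  have hq : ContinuousAt (fun Y : E n × ℝ => ‖Y.1‖ ^ 2) X := by fun_prop
  refine (continuousAt_const.mul ((h0.rpow_const (Or.inl (by linarith))).mul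
    ((continuousAt_const.sub (hq.div (continuousAt_const.mul h0) ?_)).pow 2))).neg
  have : 0 < X.2 - s0 := by linarith
  show 64 * (X.2 - s0) ≠ 0
  positivity

theorem bar_L {n : ℕ} {ν : ℝ} (hν : 0 < ν) (hν1 : ν ≤ 1) {Φ γ B s0 : ℝ} {X : E n × ℝ} (hX : s0 < X.2)
    (hB : B = n * ν⁻¹ / 16 + 2 + 1 / 8) (hγ : γ = 2 * B ^ 2 / ν + 1) (hΦ : 0 < Φ)
    {a : E n × ℝ → Fin n → Fin n → ℝ}
    (h1 : ∀ ξ : Fin n → ℝ, ν * ∑ i, ξ i ^ 2 ≤ ∑ i, ∑ j, a X i j * ξ i * ξ j)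
    (h2 : ∀ i j, |a X i j| ≤ ν⁻¹) (hq : ‖X.1‖ ^ 2 < 64 * (X.2 - s0)) :
    LVal a (fun Y : E n × ℝ => bar Φ γ s0 (‖Y.1‖ ^ 2) Y.2) X < 0 := by
  rw [(bar_jet hX).2 a]
  have hτ0 : 0 < X.2 - s0 := by linarith
  have hp := Real.rpow_pos_of_pos hτ0 (-γ)
  refine mul_neg_of_pos_of_neg (by positivity) ?_
  set τ := X.2 - s0 with hτ
  have hn : ∑ i, X.1 i ^ 2 = ‖X.1‖ ^ 2 := by
    rw [EuclideanSpace.norm_sq_eq]; simp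
  have h3 := h1 (fun i => X.1 i)
  simp only [hn] at h3
  set q := ‖X.1‖ ^ 2 / (64 * τ) with hqd
  have hq1 : q < 1 := by rw [hqd, div_lt_one (by positivity)]; exact hq
  have hq0 : 0 ≤ q := by positivity
  have h4 : ν * q / 8 ≤ (∑ i, ∑ j, a X i j * X.1 i * X.1 j) / (512 * τ) := by
    have : ν * q / 8 = ν * ‖X.1‖ ^ 2 / (512 * τ) := by rw [hqd]; field_simp; ring
    rw [this]; gcongr
  have h5 : ∑ i, a X i i ≤ n * ν⁻¹ := by
    calc ∑ i, a X i i ≤ ∑ _i : Fin n, ν⁻¹ :=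
          Finset.sum_le_sum fun i _ => (le_abs_self _).trans (h2 i i)
      _ = _ := by simp
  rw [neg_div]
  have h6 : (1 - q) * ((∑ i, a X i i) / 16) ≤ (1 - q) * (n * ν⁻¹ / 16) := by
    have : 0 ≤ 1 - q := by linarith
    gcongr
  have hB0 : 0 < B := by rw [hB]; positivity
  have hγ0 : 0 < γ := by rw [hγ]; positivity
  have h7 : γ * ν / 2 = B ^ 2 + ν / 2 := by rw [hγ]; field_simp
  have h8 : 0 < γ * (1 - q) ^ 2 - B * (1 - q) + ν / 8 := by
    have : 0 < 4 * γ * (γ * (1 - q) ^ 2 - B * (1 - q) + ν / 8) := by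
      nlinarith [sq_nonneg (2 * γ * (1 - q) - B)]
    exact pos_of_mul_pos_right this (by positivity)
  have h9 : (n:ℝ) * ν⁻¹ / 16 = B - 2 - 1 / 8 := by rw [hB]; ring
  rw [h9] at h6
  nlinarith


set_option maxHeartbeats 1000000 in
theorem barrier_main {n : ℕ} (hn : 1 ≤ n) {ν : ℝ} (hν : 0 < ν) (hν1 : ν ≤ 1) {B γ : ℝ}
    (hB : B = n * ν⁻¹ / 16 + 2 + 1 / 8) (hγ : γ = 2 * B ^ 2 / ν + 1)
    {a : E n × ℝ → Fin n → Fin n → ℝ} (ha : IsParabolicCoeff ν a (closure (Cyl (univ : Set (E n)))))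
    {u : E n × ℝ → ℝ} (hu : SolvesL a u (Cyl (univ : Set (E n)))) {R ρ₀ m : ℝ} (hρ₀ : 0 < ρ₀) (hm : 0 < m)
    (hpos : ∀ X : E n × ℝ, 0 < X.2 → ‖X.1‖ ^ 2 < 64 * X.2 → X.2 < R ^ 2 → 0 ≤ u X)
    (hstart : ∀ x : E n, ‖x‖ < ρ₀ → m ≤ u (x, ρ₀ ^ 2))
    {x : E n} {t : ℝ} (ht0 : ρ₀ ^ 2 ≤ t) (htR : t < R ^ 2)
    (hx : ‖x‖ ^ 2 ≤ 64 * (t - 63 / 64 * ρ₀ ^ 2)) :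
    0 ≤ u (x, t) + bar (m * (ρ₀ ^ 2 / 64) ^ γ) γ (63 / 64 * ρ₀ ^ 2) (‖x‖ ^ 2) t := by
  set s0 := 63 / 64 * ρ₀ ^ 2 with hs0
  set Φ := m * (ρ₀ ^ 2 / 64) ^ γ with hΦ
  have hρ2 : 0 < ρ₀ ^ 2 := by positivity
  have hΦ0 : 0 < Φ := mul_pos hm (Real.rpow_pos_of_pos (by positivity) _)
  set K : Set (E n × ℝ) := {X | ρ₀ ^ 2 ≤ X.2 ∧ X.2 ≤ t ∧ ‖X.1‖ ^ 2 ≤ 64 * (X.2 - s0)} with hK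
  have hKcl : IsClosed K := by
    have e : K = {X : E n × ℝ | ρ₀ ^ 2 ≤ X.2} ∩ ({X : E n × ℝ | X.2 ≤ t} ∩
        {X : E n × ℝ | ‖X.1‖ ^ 2 ≤ 64 * (X.2 - s0)}) := rfl
    rw [e]
    exact (isClosed_le (by fun_prop) (by fun_prop)).inter
      ((isClosed_le (by fun_prop) (by fun_prop)).inter (isClosed_le (by fun_prop) (by fun_prop)))
  have hKc : IsCompact K := by
    refine ((isCompact_closedBall (0 : E n) (64 * t + 1)).prod (isCompact_Icc (a := ρ₀ ^ 2) (b := t))).of_isClosed_subset hKcl ?_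
    rintro ⟨y, s⟩ ⟨h1, h2, h3⟩
    simp only at h1 h2 h3
    refine ⟨?_, h1, h2⟩
    simp only [mem_closedBall, dist_zero_right]
    nlinarith [sq_nonneg (‖y‖ - 1)]
  have hKprop : ∀ X ∈ K, 0 < X.2 ∧ ‖X.1‖ ^ 2 < 64 * X.2 ∧ X.2 < R ^ 2 ∧ s0 < X.2 := by
    rintro X ⟨h1, h2, h3⟩
    exact ⟨by linarith, by linarith, by linarith, by linarith⟩
  have hmem : ∀ X : E n × ℝ, 0 < X.2 → X ∈ Cyl (univ : Set (E n)) := fun X h => ⟨mem_univ _, h⟩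
  have key : ∀ X ∈ K, 0 ≤ (fun Y : E n × ℝ => u Y + bar Φ γ s0 (‖Y.1‖ ^ 2) Y.2) X := by
    refine comparison (a := a) hKc ?_ ?_
    · intro X hX
      obtain ⟨h1, h2, h3, h4⟩ := hKprop X hX
      refine RLsc.add (rlsc_interior hn hν hν1 ha hu h1 ?_) (bar_cont h4)
      have e1 : ∀ᶠ Y : E n × ℝ in nhds X, 0 < Y.2 := continuous_snd.continuousAt.eventually_const_lt h1
      have e2 : ∀ᶠ Y : E n × ℝ in nhds X, Y.2 < R ^ 2 := continuous_snd.continuousAt.eventually_lt_const h3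
      have e3 : ∀ᶠ Y : E n × ℝ in nhds X, ‖Y.1‖ ^ 2 < 64 * Y.2 :=
        (isOpen_lt (by fun_prop) (by fun_prop)).mem_nhds h2
      filter_upwards [e1, e2, e3] with Y i1 i2 i3
      exact hpos Y i1 i3 i2
    · rintro X hX hneg
      obtain ⟨h1, h2, h3, h4⟩ := hKprop X hX
      have hneg : u X + bar Φ γ s0 (‖X.1‖ ^ 2) X.2 < 0 := hneg
      have hu0 := hpos X h1 h2 h3
      have hτ0 : 0 < X.2 - s0 := by linarith
      have hqlt : ‖X.1‖ ^ 2 < 64 * (X.2 - s0) := by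
        refine lt_of_le_of_ne hX.2.2 fun he => ?_
        have : bar Φ γ s0 (‖X.1‖ ^ 2) X.2 = 0 := by
          unfold bar
          rw [he, div_self (by positivity)]; simp
        linarith
      have htlt : ρ₀ ^ 2 < X.2 := by
        refine lt_of_le_of_ne hX.1 fun he => ?_
        have hτ : X.2 - s0 = ρ₀ ^ 2 / 64 := by rw [← he, hs0]; ring
        have hxn : ‖X.1‖ < ρ₀ := by
          rw [hτ] at hqlt
          exact lt_of_pow_lt_pow_left₀ 2 hρ₀.le (by linarith)
        have hum := hstart X.1 hxn
        rw [he] at hum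
        have hb : -m ≤ bar Φ γ s0 (‖X.1‖ ^ 2) X.2 := by
          unfold bar
          rw [hΦ]
          set q := ‖X.1‖ ^ 2 / (64 * (X.2 - s0)) with hq
          have hq1 : q < 1 := by rw [hq, div_lt_one (by positivity)]; exact hqlt
          have hq0 : 0 ≤ q := by positivity
          rw [hτ, Real.rpow_neg (by positivity)]
          have hpp : 0 < (ρ₀ ^ 2 / 64) ^ γ := Real.rpow_pos_of_pos (by positivity) _
          have : m * (ρ₀ ^ 2 / 64) ^ γ * (((ρ₀ ^ 2 / 64) ^ γ)⁻¹ * (1 - q) ^ 2) = m * (1 - q) ^ 2 := by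
            field_simp
          rw [this]
          have : (1 - q) ^ 2 ≤ 1 := by nlinarith
          nlinarith
        have hum' : m ≤ u X := hum
        linarith
      have hco := ha.2 X (subset_closure (hmem X h1))
      have hps : PS u X := hu.1 X (hmem X h1)
      refine ⟨hps.add (bar_jet h4).1, ?_, ?_, ?_, ?_⟩
      · rw [LVal_add hps (bar_jet h4).1, hu.2 X (hmem X h1), zero_add]
        exact bar_L hν hν1 h4 hB hγ hΦ0 hco.1 hco.2 hqlt
      · have : {y : E n | ‖y‖ ^ 2 < 64 * (X.2 - s0)} ∈ nhds X.1 :=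
          (isOpen_lt (by fun_prop) (by fun_prop)).mem_nhds hqlt
        filter_upwards [this] with y hy
        exact ⟨hX.1, hX.2.1, le_of_lt hy⟩
      · have i1 : {s : ℝ | ‖X.1‖ ^ 2 < 64 * (s - s0)} ∈ nhds X.2 :=
          (isOpen_lt (by fun_prop) (by fun_prop)).mem_nhds hqlt
        have i2 : {s : ℝ | ρ₀ ^ 2 < s} ∈ nhds X.2 := isOpen_Ioi.mem_nhds htlt
        filter_upwards [nhdsWithin_le_nhds i1, nhdsWithin_le_nhds i2, self_mem_nhdsWithin] with s j1 j2 j3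
        exact ⟨le_of_lt j2, (le_of_lt j3).trans hX.2.1, le_of_lt j1⟩
      · intro ξ
        refine le_trans ?_ (hco.1 ξ)
        exact mul_nonneg hν.le (Finset.sum_nonneg fun i _ => sq_nonneg _)
  exact key (x, t) ⟨ht0, le_rfl, hx⟩

/-- lower bound for the barrier at the final time -/
theorem bar_final {γ m ρ₀ ρ q : ℝ} (hγ : 0 < γ) (hm : 0 ≤ m) (hρ₀ : 0 < ρ₀) (h2 : 2 * ρ₀ ≤ ρ)
    (hq0 : 0 ≤ q) (hq : q ≤ ρ ^ 2) :
    bar (m * (ρ₀ ^ 2 / 64) ^ γ) γ (63 / 64 * ρ₀ ^ 2) q (ρ ^ 2) ≤ - ((ρ₀ / ρ) ^ (8 * γ + 1) * m) := by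
  unfold bar
  rw [neg_le_neg_iff]
  have hρ : 0 < ρ := by linarith
  set s := ρ₀ / ρ with hs
  have hs0 : 0 < s := by positivity
  have hs1 : s ≤ 1 / 2 := by rw [hs, div_le_div_iff₀ hρ (by norm_num)]; linarith
  set τ := ρ ^ 2 - 63 / 64 * ρ₀ ^ 2 with hτ
  have hτ1 : ρ ^ 2 / 2 ≤ τ := by nlinarith
  have hτ2 : τ ≤ ρ ^ 2 := by nlinarith
  have hτ0 : 0 < τ := lt_of_lt_of_le (by positivity) hτ1
  have e1 : q / (64 * τ) ≤ 1 / 32 := by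
    rw [div_le_div_iff₀ (by positivity) (by norm_num)]; linarith
  have e2 : s ≤ (1 - q / (64 * τ)) ^ 2 := by nlinarith
  have e3 : s ^ 8 ≤ (ρ₀ ^ 2 / 64) / τ := by
    calc s ^ 8 = s ^ 6 * s ^ 2 := by ring
      _ ≤ (1 / 2) ^ 6 * s ^ 2 := by gcongr
      _ = (ρ₀ ^ 2 / 64) / ρ ^ 2 := by rw [hs]; field_simp; norm_num
      _ ≤ _ := by gcongr
  have e4 : s ^ (8 * γ) ≤ (ρ₀ ^ 2 / 64) ^ γ * τ ^ (-γ) := by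
    rw [Real.rpow_neg hτ0.le, ← div_eq_mul_inv, ← Real.div_rpow (by positivity) hτ0.le,
      Real.rpow_mul hs0.le]
    have : s ^ (8:ℝ) = s ^ 8 := by exact_mod_cast Real.rpow_natCast s 8
    rw [this]
    exact Real.rpow_le_rpow (by positivity) e3 hγ.le
  rw [Real.rpow_add hs0, Real.rpow_one]
  have hp : 0 ≤ s ^ (8 * γ) := Real.rpow_nonneg hs0.le _
  calc s ^ (8 * γ) * s * m ≤ ((ρ₀ ^ 2 / 64) ^ γ * τ ^ (-γ)) * (1 - q / (64 * τ)) ^ 2 * m := by gcongr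
    _ = _ := by ring

theorem growth_aux (n : ℕ) (hn : 1 ≤ n) (ν : ℝ)
    (hν : ν ∈ Ioc (0 : ℝ) 1) :
    ∃ γ₁ : ℝ, 0 < γ₁ ∧
      ∀ (a : E n × ℝ → Fin n → Fin n → ℝ),
        IsParabolicCoeff ν a (closure (Cyl (univ : Set (E n)))) →
      ∀ (K R : ℝ), 8 ≤ K → 0 < R →
      ∀ u : E n × ℝ → ℝ, SolvesL a u (Cyl (univ : Set (E n))) →
        (∀ X : E n × ℝ, 0 < X.2 → ‖X.1‖ ≤ K * Real.sqrt X.2 →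
          K * Real.sqrt X.2 ≤ K * R → 0 ≤ u X) →
      ∀ ρ₀ ρ : ℝ, 0 < ρ₀ → 2 * ρ₀ ≤ ρ → ρ ≤ R →
        (ρ₀ / ρ) ^ γ₁ *
            sInf ((fun r : ℝ =>
              sInf (u '' (ball (0 : E n) r ×ˢ {r ^ 2}))) '' Icc ρ₀ (2 * ρ₀)) ≤
          sInf (u '' (ball (0 : E n) ρ ×ˢ {ρ ^ 2})) := by
  obtain ⟨hν0, hν1⟩ := hν
  set B : ℝ := n * ν⁻¹ / 16 + 2 + 1 / 8 with hB
  set γ : ℝ := 2 * B ^ 2 / ν + 1 with hγ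
  have hγ0 : 0 < γ := by positivity
  refine ⟨8 * γ + 1, by positivity, ?_⟩
  intro a ha K R hK hR u hu hpos ρ₀ ρ hρ₀ h2 hρR
  have hρ : 0 < ρ := by linarith
  -- nonnegativity on balls
  have hball : ∀ r, 0 < r → r ≤ R → ∀ x : E n, ‖x‖ < r → 0 ≤ u (x, r ^ 2) := by
    intro r hr hrR x hx
    refine hpos (x, r ^ 2) (by simp only; positivity) ?_ ?_
    · simp only [Real.sqrt_sq hr.le]; nlinarith
    · simp only [Real.sqrt_sq hr.le]; gcongr
  have himg : ∀ r, 0 < r → r ≤ R → ∀ v ∈ u '' (ball (0 : E n) r ×ˢ {r ^ 2}), 0 ≤ v := by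
    rintro r hr hrR v ⟨⟨x, t⟩, ⟨hx, ht⟩, rfl⟩
    simp only [mem_singleton_iff] at ht
    subst ht
    exact hball r hr hrR x (by simpa using hx)
  set m := sInf ((fun r : ℝ => sInf (u '' (ball (0 : E n) r ×ˢ {r ^ 2}))) '' Icc ρ₀ (2 * ρ₀)) with hm
  have hf0 : ∀ v ∈ (fun r : ℝ => sInf (u '' (ball (0 : E n) r ×ˢ {r ^ 2}))) '' Icc ρ₀ (2 * ρ₀), 0 ≤ v := by
    rintro v ⟨r, hr, rfl⟩
    exact Real.sInf_nonneg (himg r (by linarith [hr.1]) (by linarith [hr.2]))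
  have hm0 : 0 ≤ m := Real.sInf_nonneg hf0
  have hstart : ∀ x : E n, ‖x‖ < ρ₀ → m ≤ u (x, ρ₀ ^ 2) := by
    intro x hx
    have h3 : m ≤ sInf (u '' (ball (0 : E n) ρ₀ ×ˢ {ρ₀ ^ 2})) :=
      csInf_le ⟨0, hf0⟩ ⟨ρ₀, ⟨le_rfl, by linarith⟩, rfl⟩
    refine h3.trans (csInf_le ⟨0, himg ρ₀ hρ₀ (by linarith)⟩ ⟨(x, ρ₀ ^ 2), ⟨by simpa using hx, rfl⟩, rfl⟩)
  refine le_csInf (Nonempty.image _ ⟨((0 : E n), ρ ^ 2), by simpa using hρ, rfl⟩) ?_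
  rintro v ⟨⟨x, t⟩, ⟨hx, ht⟩, rfl⟩
  simp only [mem_singleton_iff] at ht
  subst ht
  have hx : ‖x‖ < ρ := by simpa using hx
  rcases hm0.eq_or_lt with hm00 | hm00
  · rw [← hm00, mul_zero]
    exact hball ρ hρ hρR x hx
  have hpos' : ∀ X : E n × ℝ, 0 < X.2 → ‖X.1‖ ^ 2 < 64 * X.2 → X.2 < R ^ 2 → 0 ≤ u X := by
    intro X h3 h4 h5
    have hs := Real.sqrt_nonneg X.2
    have hss := Real.sq_sqrt h3.le
    refine hpos X h3 ?_ ?_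
    · have h6 : ‖X.1‖ ≤ 8 * Real.sqrt X.2 := by
        refine le_of_sq_le_sq ?_ (by positivity)
        rw [mul_pow, hss]; linarith
      nlinarith
    · have h6 : Real.sqrt X.2 ≤ R := by
        rw [Real.sqrt_le_left hR.le]; exact h5.le
      gcongr
  have hxsq : ‖x‖ ^ 2 ≤ ρ ^ 2 := by gcongr
  have hρ4 : 4 * ρ₀ ^ 2 ≤ ρ ^ 2 := by nlinarith
  have hρ₀2 : 0 < ρ₀ ^ 2 := by positivity
  have hρR2 : ρ ^ 2 ≤ R ^ 2 := by gcongr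
  have hlim : 0 ≤ u (x, ρ ^ 2) + bar (m * (ρ₀ ^ 2 / 64) ^ γ) γ (63 / 64 * ρ₀ ^ 2) (‖x‖ ^ 2) (ρ ^ 2) := by
    have c1 : ContinuousAt (fun t => u (x, t)) (ρ ^ 2) :=
      (hu.1 (x, ρ ^ 2) ⟨mem_univ _, by show 0 < ρ ^ 2; positivity⟩).2.continuousAt
    have c2 : ContinuousAt (fun t => bar (m * (ρ₀ ^ 2 / 64) ^ γ) γ (63 / 64 * ρ₀ ^ 2) (‖x‖ ^ 2) t) (ρ ^ 2) :=
      (bar_jet (X := (x, ρ ^ 2)) (by simp only; linarith)).1.2.continuousAt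
    refine ge_of_tendsto ((c1.add c2).tendsto.mono_left (nhdsWithin_le_nhds (s := Iio (ρ ^ 2)))) ?_
    have i1 : Ioo (ρ₀ ^ 2) (ρ ^ 2) ∈ nhdsWithin (ρ ^ 2) (Iio (ρ ^ 2)) := Ioo_mem_nhdsLT (by linarith)
    have i2 : Ioi (ρ ^ 2 / 64 + 63 / 64 * ρ₀ ^ 2) ∈ nhds (ρ ^ 2) := isOpen_Ioi.mem_nhds (by
      simp only [mem_Ioi]; linarith)
    filter_upwards [i1, nhdsWithin_le_nhds i2] with t j1 j2
    simp only [mem_Ioi] at j2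
    exact barrier_main hn hν0 hν1 hB hγ ha hu hρ₀ hm00 hpos' hstart j1.1.le (by linarith [j1.2]) (by linarith)
  have := bar_final hγ0 hm0 hρ₀ h2 (sq_nonneg ‖x‖) hxsq
  linarith

/-- **Lemma 4.3(a)**: if `u` solves `Lu = 0` in `Q = ℝⁿ × (0,∞)` and `u ≥ 0` on the
paraboloid piece `U_R = {(x,t) : t > 0, |x| ≤ K√t ≤ KR}` with `K ≥ 8`, `R > 0`, then
`f₁(ρ) = inf_{B_ρ(0) × {ρ²}} u` satisfies
`f₁(ρ) ≥ (ρ₀/ρ)^{γ₁} · inf_{ρ₀ ≤ r ≤ 2ρ₀} f₁(r)` for `0 < 2ρ₀ ≤ ρ ≤ R`, with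
`γ₁ = γ₁(n, ν) > 0`. -/
theorem growth_lemma_whole_space (n : ℕ) (hn : 1 ≤ n) (ν : ℝ)
    (hν : ν ∈ Ioc (0 : ℝ) 1) :
    ∃ γ₁ : ℝ, 0 < γ₁ ∧
      ∀ (a : E n × ℝ → Fin n → Fin n → ℝ),
        IsParabolicCoeff ν a (closure (Cyl (univ : Set (E n)))) →
      ∀ (K R : ℝ), 8 ≤ K → 0 < R →
      ∀ u : E n × ℝ → ℝ, SolvesL a u (Cyl (univ : Set (E n))) →
        (∀ X : E n × ℝ, 0 < X.2 → ‖X.1‖ ≤ K * Real.sqrt X.2 →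
          K * Real.sqrt X.2 ≤ K * R → 0 ≤ u X) →
      ∀ ρ₀ ρ : ℝ, 0 < ρ₀ → 2 * ρ₀ ≤ ρ → ρ ≤ R →
        (ρ₀ / ρ) ^ γ₁ *
            sInf ((fun r : ℝ =>
              sInf (u '' (ball (0 : E n) r ×ˢ {r ^ 2}))) '' Icc ρ₀ (2 * ρ₀)) ≤
          sInf (u '' (ball (0 : E n) ρ ×ˢ {ρ ^ 2})) := by
  exact growth_aux n hn ν hν
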